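/- arXiv:1702.08442 — 3 statements merged into one kernel-verified Lean document; each statement's English description precedes it below -/
import Mathlib

section
/- Let c₁, c₂, c₃ ∈ ℝ² be the vertices of an equilateral triangle of side 2, and let the tricusp be the closed curvilinear triangle consisting of the points of the triangle at distance at least 1 from each cₖ. Let P = (p, r) be a jammed packing of n disks in the tricusp. If the n − 1 real numbers r₂/r₁, …, rₙ/r₁ are generic (algebraically independent over ℚ), then the total number of contacts of P (disk–disk contacts together with disk–boundary contacts) is exactly 2n + 1, and the equilibrium stresses of P form a one-dimensional vector space; that is, P is isostatic. -/
noncomputable section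

open scoped RealInnerProductSpace

namespace IsostaticPaper

/-- Points of the Euclidean plane `ℝ²`. -/
abbrev Pt : Type := EuclideanSpace ℝ (Fin 2)

/-- The point `(x, y) ∈ ℝ²`. -/
def vec (x y : ℝ) : Pt := (WithLp.equiv 2 (Fin 2 → ℝ)).symm ![x, y]

/-- The lattice `Λ ⊆ ℝ²` spanned over `ℤ` by the two vectors `v₁, v₂`. -/
def lat (v₁ v₂ : Pt) : Set Pt :=
  {l : Pt | ∃ z₁ z₂ : ℤ, l = (z₁ : ℝ) • v₁ + (z₂ : ℝ) • v₂}

/-- `(p, r)` is a packing of disks in the flat torus `ℝ²/Λ`: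
all radii are positive and `‖pᵢ - pⱼ + λ‖ ≥ rᵢ + rⱼ` for all `i, j` and all
`λ ∈ Λ` with `(j, λ) ≠ (i, 0)`. -/
def IsPacking (Λ : Set Pt) {ι : Type} (p : ι → Pt) (r : ι → ℝ) : Prop :=
  (∀ i, 0 < r i) ∧
  ∀ i j : ι, ∀ l ∈ Λ, ¬(j = i ∧ l = 0) → r i + r j ≤ ‖p i - p j + l‖

/-- A contact of the packing `(p, r)` is a triple `(i, j, λ)`, `λ ∈ Λ`,
`(j, λ) ≠ (i, 0)`, with `‖pᵢ - pⱼ + λ‖ = rᵢ + rⱼ`. -/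
def IsContact (Λ : Set Pt) {ι : Type} (p : ι → Pt) (r : ι → ℝ) (c : ι × ι × Pt) : Prop :=
  c.2.2 ∈ Λ ∧ ¬(c.2.1 = c.1 ∧ c.2.2 = 0) ∧ ‖p c.1 - p c.2.1 + c.2.2‖ = r c.1 + r c.2.1

/-- A packing `(p, r)` in `ℝ²/Λ` is collectively jammed if every continuous path of
configurations `t ↦ q t`, `t ∈ [0,1]`, starting at `p` and keeping `(q t, r)` a packing,
moves `p` only by translations. -/
def CollectivelyJammed (Λ : Set Pt) {ι : Type} (p : ι → Pt) (r : ι → ℝ) : Prop :=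
  ∀ q : ℝ → ι → Pt,
    (∀ i, ContinuousOn (fun t => q t i) (Set.Icc 0 1)) →
    q 0 = p →
    (∀ t ∈ Set.Icc (0:ℝ) 1, IsPacking Λ (q t) r) →
    ∀ t ∈ Set.Icc (0:ℝ) 1, ∀ i j, q t i - p i = q t j - p j

/-- Euclidean distance between two configurations of centers. -/
def pdist {ι : Type} [Fintype ι] (p q : ι → Pt) : ℝ :=
  Real.sqrt (∑ i, ‖p i - q i‖ ^ 2)

/-- Euclidean distance between two vectors of radii. -/
def rdist {ι : Type} [Fintype ι] (r s : ι → ℝ) : ℝ :=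
  Real.sqrt (∑ i, (r i - s i) ^ 2)

/-- Determinant of the pair of lattice basis vectors `v₁, v₂`. -/
def det2 (v₁ v₂ : Pt) : ℝ := v₁ 0 * v₂ 1 - v₁ 1 * v₂ 0

/-- Density of a packing with radii `r` in the torus with lattice basis `v₁, v₂`. -/
def density (v₁ v₂ : Pt) {ι : Type} [Fintype ι] (r : ι → ℝ) : ℝ :=
  Real.pi * (∑ i, r i ^ 2) / |det2 v₁ v₂|

/-- `(p, r)` is locally maximally dense in the torus with lattice basis `v₁, v₂`:
it is a packing and, for some `ε > 0`, every nearby packing whose radii are a positive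
scalar multiple of `r` has density at most that of `(p, r)`. -/
def LocallyMaxDense (v₁ v₂ : Pt) {ι : Type} [Fintype ι] (p : ι → Pt) (r : ι → ℝ) : Prop :=
  IsPacking (lat v₁ v₂) p r ∧
  ∃ ε > 0, ∀ (q : ι → Pt) (t : ℝ), 0 < t →
    IsPacking (lat v₁ v₂) q (fun i => t * r i) →
    pdist q p < ε → rdist (fun i => t * r i) r < ε →
    density v₁ v₂ (fun i => t * r i) ≤ density v₁ v₂ r

/-- An infinitesimal flex `p'` of the packing: `(pᵢ - pⱼ + λ) · (p'ᵢ - p'ⱼ) ≥ 0`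
for every contact `(i, j, λ)`. -/
def IsInfFlex (Λ : Set Pt) {ι : Type} (p : ι → Pt) (r : ι → ℝ) (p' : ι → Pt) : Prop :=
  ∀ c : ι × ι × Pt, IsContact Λ p r c →
    0 ≤ ⟪p c.1 - p c.2.1 + c.2.2, p' c.1 - p' c.2.1⟫

/-- The packing is infinitesimally rigid if every infinitesimal flex is trivial
(all `p'ᵢ` equal). -/
def InfinitesimallyRigid (Λ : Set Pt) {ι : Type} (p : ι → Pt) (r : ι → ℝ) : Prop :=
  ∀ p' : ι → Pt, IsInfFlex Λ p r p' → ∀ i j, p' i = p' j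

/-- The space of equilibrium stresses of a packing whose (finite) set of ordered
contact triples is `K`: scalars on contacts with `ω(i,j,λ) = ω(j,i,-λ)`, vanishing off
`K`, in equilibrium at every vertex. -/
def stressSpace {n : ℕ} (K : Finset (Fin n × Fin n × Pt)) (p : Fin n → Pt) :
    Submodule ℝ ((Fin n × Fin n × Pt) → ℝ) where
  carrier := {ω | (∀ c ∉ K, ω c = 0) ∧
    (∀ i j l, ω (i, j, l) = ω (j, i, -l)) ∧
    (∀ i, ∑ c ∈ K.filter (fun c => c.1 = i), ω c • (p c.1 - p c.2.1 + c.2.2) = 0)}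
  zero_mem' := ⟨fun _ _ => rfl, fun _ _ _ => rfl, fun i => by simp⟩
  add_mem' := by
    rintro ω₁ ω₂ ⟨h1, h2, h3⟩ ⟨g1, g2, g3⟩
    refine ⟨fun c hc => ?_, fun i j l => ?_, fun i => ?_⟩
    · simp [h1 c hc, g1 c hc]
    · simp [h2 i j l, g2 i j l]
    · simp only [Pi.add_apply, add_smul, Finset.sum_add_distrib, h3 i, g3 i, add_zero]
  smul_mem' := by
    rintro t ω ⟨h1, h2, h3⟩
    refine ⟨fun c hc => ?_, fun i j l => ?_, fun i => ?_⟩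
    · simp [h1 c hc]
    · simp [h2 i j l]
    · simp only [Pi.smul_apply, smul_assoc, ← Finset.smul_sum, h3 i, smul_zero]


/-- The tricusp determined by the three centers `c k`: the points of the triangle
`conv{c₁,c₂,c₃}` at distance at least `1` from each `c k`. -/
def tricusp (c : Fin 3 → Pt) : Set Pt :=
  {x | x ∈ convexHull ℝ (Set.range c) ∧ ∀ k, 1 ≤ ‖x - c k‖}

/-- A packing of disks in the tricusp with vertex circles centered at `c k`. -/
def TricuspPacking (c : Fin 3 → Pt) {ι : Type} (p : ι → Pt) (r : ι → ℝ) : Prop :=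
  (∀ i, 0 < r i) ∧
  (∀ i j, i ≠ j → r i + r j ≤ ‖p i - p j‖) ∧
  (∀ i k, 1 + r i ≤ ‖p i - c k‖) ∧
  (∀ i, Metric.closedBall (p i) (r i) ⊆ tricusp c)

/-- A packing in the tricusp is jammed if every continuous motion of the centers
preserving the radii and all constraints is constant. -/
def TricuspJammed (c : Fin 3 → Pt) {ι : Type} (p : ι → Pt) (r : ι → ℝ) : Prop :=
  ∀ q : ℝ → ι → Pt,
    (∀ i, ContinuousOn (fun t => q t i) (Set.Icc 0 1)) →
    q 0 = p →
    (∀ t ∈ Set.Icc (0:ℝ) 1, TricuspPacking c (q t) r) →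
    ∀ t ∈ Set.Icc (0:ℝ) 1, q t = p

private lemma add_shuffle {M : Type*} [AddCommGroup M] (a b c d : M)
    (h1 : a + c = 0) (h2 : b + d = 0) : a + b + (c + d) = 0 := by
  have h : a + b + (c + d) = a + c + (b + d) := by abel
  rw [h, h1, h2, add_zero]

/-- The space of equilibrium stresses of a packing `(p, r)` in the tricusp with
vertex circles centered at `c k`: scalars `ω.1 i j` on disk–disk contacts (symmetric,
vanishing on non-contacts) and `ω.2 i k` on disk–boundary contacts, in equilibrium
at every disk. -/
def tricuspStressSpace (c : Fin 3 → Pt) {n : ℕ} (p : Fin n → Pt) (r : Fin n → ℝ) :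
    Submodule ℝ ((Fin n → Fin n → ℝ) × (Fin n → Fin 3 → ℝ)) where
  carrier := {ω | (∀ i j, ¬(i ≠ j ∧ ‖p i - p j‖ = r i + r j) → ω.1 i j = 0) ∧
    (∀ i j, ω.1 i j = ω.1 j i) ∧
    (∀ i k, ‖p i - c k‖ ≠ 1 + r i → ω.2 i k = 0) ∧
    (∀ i, (∑ j, ω.1 i j • (p i - p j)) + ∑ k, ω.2 i k • (p i - c k) = 0)}
  zero_mem' := ⟨fun _ _ _ => rfl, fun _ _ => rfl, fun _ _ _ => rfl, fun i => by simp⟩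
  add_mem' := by
    rintro ω₁ ω₂ ⟨h1, h2, h3, h4⟩ ⟨g1, g2, g3, g4⟩
    refine ⟨fun i j hij => ?_, fun i j => ?_, fun i k hik => ?_, fun i => ?_⟩
    · simp [h1 i j hij, g1 i j hij]
    · simp [h2 i j, g2 i j]
    · simp [h3 i k hik, g3 i k hik]
    · simp only [Prod.fst_add, Prod.snd_add, Pi.add_apply, add_smul,
        Finset.sum_add_distrib]
      exact add_shuffle _ _ _ _ (h4 i) (g4 i)
  smul_mem' := by
    rintro t ω ⟨h1, h2, h3, h4⟩
    refine ⟨fun i j hij => ?_, fun i j => ?_, fun i k hik => ?_, fun i => ?_⟩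
    · simp [h1 i j hij]
    · simp [h2 i j]
    · simp [h3 i k hik]
    · simp only [Prod.smul_fst, Prod.smul_snd, Pi.smul_apply, smul_assoc,
        ← Finset.smul_sum, ← smul_add, h4 i, smul_zero]

theorem exists_ringHom_lift_of_formallySmooth {S L B : Type*} [CommRing S] [CommRing L]
    [CommRing B] [Algebra S L] [Algebra.FormallySmooth S L] (g : S →+* B) (π : B →+* L)
    (hπ : Function.Surjective π) (hker : IsNilpotent (RingHom.ker π))
    (hg : π.comp g = algebraMap S L) :
    ∃ φ : L →+* B, (∀ x, π (φ x) = x) ∧ ∀ s, φ (algebraMap S L s) = g s := by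
  let := g.toAlgebra
  let π' : B →ₐ[S] L := { π with commutes' := fun s => DFunLike.congr_fun hg s }
  let φ := Algebra.FormallySmooth.liftOfSurjective (AlgHom.id S L) π' hπ hker
  exact ⟨φ.toRingHom,
    Algebra.FormallySmooth.liftOfSurjective_apply (AlgHom.id S L) π' hπ hker, φ.commutes⟩

open scoped IntermediateField.algebraAdjoinAdjoin in
theorem formallySmooth_adjoin_of_isTranscendenceBasis {ι K L : Type*} [Field K] [Field L]
    [CharZero K] [Algebra K L] {v : ι → L} (hv : IsTranscendenceBasis K v) :
    Algebra.FormallySmooth (Algebra.adjoin K (Set.range v)) L := by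
  have := hv.isAlgebraic_field
  have : Algebra.FormallySmooth (Algebra.adjoin K (Set.range v))
      (IntermediateField.adjoin K (Set.range v)) := .of_isLocalization (nonZeroDivisors _)
  have : Algebra.FormallyEtale (IntermediateField.adjoin K (Set.range v)) L :=
    Algebra.FormallyEtale.of_isSeparable _ L
  exact .comp _ (IntermediateField.adjoin K (Set.range v)) _

theorem exists_derivation_of_algebraicIndependent {ι : Type*} {x : ι → ℝ}
    (hx : AlgebraicIndependent ℚ x) (c : ι → ℝ) :
    ∃ D : Derivation ℚ ℝ ℝ, ∀ i, D (x i) = c i := by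
  classical
  obtain ⟨s, hs, hsx⟩ := exists_isTranscendenceBasis_superset hx.to_subtype_range
  have := formallySmooth_adjoin_of_isTranscendenceBasis hsx
  let e := hsx.1.aevalEquiv
  let d : ℝ → ℝ := Function.extend x c 0
  let g₀ : MvPolynomial s ℚ →ₐ[ℚ] DualNumber ℝ :=
    MvPolynomial.aeval fun i : s => TrivSqZeroExt.inl (i : ℝ) + TrivSqZeroExt.inr (d i)
  let π : DualNumber ℝ →ₐ[ℚ] ℝ := TrivSqZeroExt.fstHom ℚ ℝ ℝ
  have hπg : ∀ p, π (g₀ p) = MvPolynomial.aeval ((↑) : s → ℝ) p := by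
    have : π.comp g₀ = MvPolynomial.aeval ((↑) : s → ℝ) :=
      MvPolynomial.algHom_ext (fun i => by simp [π, g₀])
    exact fun p => DFunLike.congr_fun this p
  have hsurj : Function.Surjective π.toRingHom := fun y => ⟨TrivSqZeroExt.inl y, rfl⟩
  have hker : IsNilpotent (RingHom.ker π.toRingHom) := ⟨2, TrivSqZeroExt.kerIdeal_sq ℝ ℝ⟩
  obtain ⟨φ, h1, h2⟩ := exists_ringHom_lift_of_formallySmooth
    (g₀.comp e.symm.toAlgHom).toRingHom π.toRingHom hsurj hker
    (by
      ext y
      obtain ⟨p, rfl⟩ := e.surjective y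
      change π (g₀ (e.symm (e p))) = _
      rw [e.symm_apply_apply]
      exact hπg p)
  have hfst : ∀ y, (φ y).fst = y := h1
  let D₀ : ℝ →ₗ[ℚ] ℝ :=
    ((TrivSqZeroExt.sndHom ℝ ℝ).toAddMonoidHom.comp φ.toAddMonoidHom).toRatLinearMap
  refine ⟨Derivation.mk' D₀ ?_, ?_⟩
  · intro a b
    change (φ (a * b)).snd = a • (φ b).snd + b • (φ a).snd
    simp [map_mul, hfst, mul_comm]
  · intro i
    change (φ (x i)).snd = c i
    have h3 := h2 (e (MvPolynomial.X ⟨x i, hs ⟨i, rfl⟩⟩))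
    have h4 : (algebraMap _ ℝ) (e (MvPolynomial.X ⟨x i, hs ⟨i, rfl⟩⟩)) = x i := by
      change MvPolynomial.aeval _ _ = _
      simp
    rw [h4] at h3
    rw [h3]
    simp [g₀, d, hx.injective.extend_apply]

/-- The sum of `φ a b` over the consecutive pairs `a, b` of a list. -/
def adjSum {E : Type*} (φ : E → E → ℤ) : List E → ℤ
  | [] => 0
  | [_] => 0
  | a :: b :: l => φ a b + adjSum φ (b :: l)

/-- `φ` extended by zero to optional arguments. -/
def optLink {E : Type*} (φ : E → E → ℤ) : Option E → Option E → ℤ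
  | some a, some b => φ a b
  | _, _ => 0

section adjSum
variable {E : Type*} (φ : E → E → ℤ)

@[simp] theorem optLink_none_left (o : Option E) : optLink φ none o = 0 := by
  cases o <;> rfl

@[simp] theorem optLink_none_right (o : Option E) : optLink φ o none = 0 := by
  cases o <;> rfl

@[simp] theorem optLink_some (a b : E) : optLink φ (some a) (some b) = φ a b := rfl

@[simp] theorem adjSum_nil : adjSum φ [] = 0 := rfl

theorem adjSum_cons (a : E) (l : List E) :
    adjSum φ (a :: l) = optLink φ (some a) l.head? + adjSum φ l := by
  cases l <;> simp [adjSum]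

theorem adjSum_append (l m : List E) :
    adjSum φ (l ++ m) = adjSum φ l + optLink φ l.getLast? m.head? + adjSum φ m := by
  induction l with
  | nil => simp
  | cons a l ih =>
    rw [List.cons_append, adjSum_cons, ih, adjSum_cons]
    cases l with
    | nil => simp
    | cons b l => simp [List.getLast?_cons]; ring

theorem adjSum_reverse (hφ : ∀ a b, φ a b = φ b a) (l : List E) :
    adjSum φ l.reverse = adjSum φ l := by
  induction l with
  | nil => rfl
  | cons a l ih =>
    rw [List.reverse_cons, adjSum_append, ih, adjSum_cons φ a l, List.getLast?_reverse]
    cases l.head? with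
    | none => simp [adjSum]
    | some b =>
      simp only [adjSum, List.head?_cons, optLink_some, hφ b a]
      ring

theorem adjSum_congr {φ ψ : E → E → ℤ} {l : List E}
    (h : l.Pairwise fun a b => φ a b = ψ a b) : adjSum φ l = adjSum ψ l := by
  induction l with
  | nil => rfl
  | cons a l ih =>
    rw [List.pairwise_cons] at h
    rw [adjSum_cons, adjSum_cons, ih h.2]
    cases l with
    | nil => simp
    | cons b l => simp [h.1 b]

theorem adjSum_neg (l : List E) : adjSum (fun a b => -φ a b) l = -adjSum φ l := by
  induction l with
  | nil => rfl
  | cons a l ih =>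
    rw [adjSum_cons, adjSum_cons, ih]
    cases l.head? <;> simp
    ring

end adjSum

/-- The indicator of a sign change. -/
def signJump {E : Type*} (σ : E → Bool) (a b : E) : ℤ := if σ a = σ b then 0 else 1

/-- A sign change between two edges counts positively if the edges have the same left end,
and negatively otherwise. -/
def signedJump {E V : Type*} [DecidableEq V] (σ : E → Bool) (lv : E → V) (a b : E) : ℤ :=
  if lv a = lv b then signJump σ a b else -signJump σ a b

section signJump
variable {E : Type*} (σ : E → Bool)

theorem signJump_comm (a b : E) : signJump σ a b = signJump σ b a := by
  simp [signJump, eq_comm]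

theorem signJump_nonneg (a b : E) : 0 ≤ signJump σ a b := by
  unfold signJump; split_ifs <;> simp

theorem signJump_le_one (a b : E) : signJump σ a b ≤ 1 := by
  unfold signJump; split_ifs <;> simp

theorem even_adjSum_signJump_add (a : E) (l : List E) :
    Even (adjSum (signJump σ) (a :: l) + signJump σ a ((a :: l).getLast (by simp))) := by
  induction l generalizing a with
  | nil => simp [adjSum, signJump]
  | cons b l ih =>
    have h := ih b
    rw [List.getLast_cons (by simp)]
    generalize (b :: l).getLast (by simp) = z at h ⊢
    rw [adjSum_cons]
    simp only [List.head?_cons, optLink_some]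
    generalize adjSum (signJump σ) (b :: l) = s at h ⊢
    have : Even (signJump σ a b + signJump σ b z + signJump σ a z) := by
      unfold signJump
      cases σ a <;> cases σ b <;> cases σ z <;> simp
    have h2 := h.add this
    have h3 : signJump σ a b + s + signJump σ a z =
      (s + signJump σ b z + (signJump σ a b + signJump σ b z + signJump σ a z))
        - (signJump σ b z + signJump σ b z) := by ring
    rw [h3]
    exact h2.sub ⟨_, rfl⟩

theorem four_le_cyclic_signJump {l : List E}
    (h : 3 ≤ adjSum (signJump σ) l) :
    4 ≤ adjSum (signJump σ) l + optLink (signJump σ) l.head? l.getLast? := by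
  cases l with
  | nil => simp at h
  | cons a l =>
    have h1 := even_adjSum_signJump_add σ a l
    rw [List.getLast?_eq_some_getLast (by simp)]
    simp only [List.head?_cons, optLink_some]
    have h2 := signJump_nonneg σ a ((a :: l).getLast (by simp))
    obtain ⟨k, hk⟩ := h1
    omega

end signJump

section signedJump
variable {E V : Type*} [DecidableEq V] {σ : E → Bool} {lv : E → V}

theorem abs_optLink_signedJump_le (a b : Option E) : |optLink (signedJump σ lv) a b| ≤ 1 := by
  cases a <;> cases b <;> simp
  unfold signedJump signJump
  split_ifs <;> simp

theorem optLink_signedJump_of_ne {a b : Option E}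
    (h : ∀ x ∈ a, ∀ y ∈ b, lv x ≠ lv y) :
    optLink (signedJump σ lv) a b = -optLink (signJump σ) a b := by
  cases a <;> cases b <;> simp
  simp at h
  simp [signedJump, h]

theorem optLink_signJump_mem (a b : Option E) :
    0 ≤ optLink (signJump σ) a b ∧ optLink (signJump σ) a b ≤ 1 := by
  cases a <;> cases b <;> simp [signJump_nonneg, signJump_le_one]

theorem optLink_signedJump_le (a b : Option E) :
    optLink (signedJump σ lv) a b ≤ optLink (signJump σ) a b := by
  cases a <;> cases b <;> simp
  unfold signedJump signJump
  split_ifs <;> simp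

theorem optLink_signJump_perimeter_left (a : Option E) (b c : E) :
    optLink (signJump σ) a (some b) + optLink (signJump σ) a (some c) + signJump σ b c ≤ 2 := by
  cases a with
  | none => simp; linarith [signJump_le_one σ b c]
  | some a =>
    simp only [optLink_some, signJump]
    cases σ a <;> cases σ b <;> cases σ c <;> simp

theorem optLink_signJump_perimeter_right (a : Option E) (b c : E) :
    optLink (signJump σ) (some b) a + optLink (signJump σ) (some c) a + signJump σ b c ≤ 2 := by
  cases a with
  | none => simp; linarith [signJump_le_one σ b c]
  | some a =>
    simp only [optLink_some, signJump]
    cases σ a <;> cases σ b <;> cases σ c <;> simp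

/-- Passing a vertex `v` with at least four sign changes around it does not decrease the signed
count of sign changes between neighbouring edges. -/
theorem adjSum_signedJump_le_of_vertex {v : V} {A B L R : List E}
    (hA : ∀ e ∈ A, lv e ≠ v) (hB : ∀ e ∈ B, lv e ≠ v)
    (hR : ∀ e ∈ R, lv e = v)
    (hL : L.Pairwise fun a b => lv a ≠ lv b)
    (h3 : 3 ≤ adjSum (signJump σ) (L.reverse ++ R)) :
    adjSum (signedJump σ lv) (A ++ L ++ B) ≤ adjSum (signedJump σ lv) (A ++ R ++ B) := by
  have h4 := four_le_cyclic_signJump σ h3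
  have hsL : adjSum (signedJump σ lv) L = -adjSum (signJump σ) L := by
    rw [← adjSum_neg]
    exact adjSum_congr (hL.imp fun h => by simp [signedJump, h])
  have hsR : adjSum (signedJump σ lv) R = adjSum (signJump σ) R :=
    adjSum_congr (List.pairwise_of_forall_mem_list fun a ha b hb => by
      simp [signedJump, hR a ha, hR b hb])
  have e1 := optLink_signedJump_le (σ := σ) (lv := lv) A.getLast? L.head?
  have e2 := optLink_signedJump_le (σ := σ) (lv := lv) L.getLast? B.head?
  have e3 : optLink (signedJump σ lv) A.getLast? R.head? =
      -optLink (signJump σ) A.getLast? R.head? :=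
    optLink_signedJump_of_ne fun x hx y hy => by
      rw [hR y (List.mem_of_head? hy)]; exact hA x (List.mem_of_getLast? hx)
  have e4 : optLink (signedJump σ lv) R.getLast? B.head? =
      -optLink (signJump σ) R.getLast? B.head? :=
    optLink_signedJump_of_ne fun x hx y hy => by
      rw [hR x (List.mem_of_getLast? hx)]; exact (hB y (List.mem_of_head? hy)).symm
  have hab := abs_le.1 (abs_optLink_signedJump_le (σ := σ) (lv := lv) A.getLast? B.head?)
  rw [adjSum_append, adjSum_reverse _ (signJump_comm σ), List.getLast?_reverse] at h4 h3
  rw [List.append_assoc, List.append_assoc]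
  simp only [adjSum_append, hsL, hsR, List.head?_append, List.getLast?_append,
    List.head?_reverse, List.getLast?_reverse] at *
  rcases hL0 : L.head? with _ | hl
  · have : L = [] := by simpa using hL0
    subst this
    rcases hR0 : R.head? with _ | hr
    · have : R = [] := by simpa using hR0
      subst this
      simp at h3
    · obtain ⟨lr, hlr⟩ : ∃ lr, R.getLast? = some lr := by
        cases R with
        | nil => simp at hR0
        | cons a R => exact ⟨_, List.getLast?_eq_some_getLast (by simp)⟩
      rw [hR0] at e3
      rw [hlr] at e4
      have := optLink_signJump_mem (σ := σ) A.getLast? (some hr)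
      have := optLink_signJump_mem (σ := σ) (some lr) B.head?
      simp [hR0, hlr, e3, e4] at *
      omega
  · obtain ⟨ll, hll⟩ : ∃ ll, L.getLast? = some ll := by
      cases L with
      | nil => simp at hL0
      | cons a R => exact ⟨_, List.getLast?_eq_some_getLast (by simp)⟩
    rw [hL0] at e1
    rw [hll] at e2
    have := optLink_signJump_mem (σ := σ) A.getLast? (some hl)
    have := optLink_signJump_mem (σ := σ) (some ll) B.head?
    rcases hR0 : R.head? with _ | hr
    · have : R = [] := by simpa using hR0
      subst this
      simp [hL0, hll] at *
      omega
    · obtain ⟨lr, hlr⟩ : ∃ lr, R.getLast? = some lr := by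
        cases R with
        | nil => simp at hR0
        | cons a R => exact ⟨_, List.getLast?_eq_some_getLast (by simp)⟩
      rw [hR0] at e3
      rw [hlr] at e4
      have t1 := optLink_signJump_perimeter_left (σ := σ) A.getLast? hl hr
      have t2 := optLink_signJump_perimeter_right (σ := σ) B.head? ll lr
      simp [hL0, hll, hR0, hlr, e3, e4] at *
      omega

end signedJump

open Polynomial in
/-- A polynomial with the signs of a list of numbers `b`, one root for each sign change. -/
theorem exists_polynomial_sign {E : Type*} (τ b : E → ℝ) (a : E) (l : List E)
    (hτ : (a :: l).Pairwise fun e f => τ e < τ f) (hb : ∀ e ∈ a :: l, b e ≠ 0) :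
    ∃ q : ℝ[X], (q.natDegree : ℤ) ≤ adjSum (signJump fun e => decide (0 < b e)) (a :: l) ∧
      (∀ e ∈ a :: l, 0 < q.eval (τ e) * b e) ∧ ∀ t ≤ τ a, 0 < q.eval t * b a := by
  induction l generalizing a with
  | nil =>
    have h : 0 < b a * b a := mul_self_pos.2 (hb a (by simp))
    exact ⟨C (b a), by simp [adjSum], by simpa using hb a, fun _ _ => by simpa using h⟩
  | cons c l ih =>
    rw [List.pairwise_cons] at hτ
    obtain ⟨q, hd, hq, ht⟩ := ih c hτ.2 fun e he => hb e (List.mem_cons_of_mem _ he)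
    have hac : τ a < τ c := hτ.1 c (by simp)
    have hba := hb a (by simp)
    have hbc := hb c (by simp)
    rw [adjSum_cons]
    simp only [List.head?_cons, optLink_some]
    by_cases hs : (0 < b a ↔ 0 < b c)
    · have key : ∀ t ≤ τ a, 0 < q.eval t * b a := fun t h => by
        have := ht t (by linarith)
        rcases lt_or_gt_of_ne hba with h1 | h1
        · have h2 : b c < 0 := lt_of_le_of_ne (not_lt.1 fun h => by linarith [hs.2 h]) hbc
          have := neg_of_mul_pos_left this h2.le
          exact mul_pos_of_neg_of_neg this h1
        · have := pos_of_mul_pos_left this (hs.1 h1).le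
          exact mul_pos this h1
      refine ⟨q, by simpa [signJump, hs] using hd, ?_, key⟩
      intro e he
      rcases List.mem_cons.1 he with rfl | he
      · exact key _ le_rfl
      · exact hq e he
    · have hopp : b a * b c < 0 := by
        rcases lt_or_gt_of_ne hba with h1 | h1 <;> rcases lt_or_gt_of_ne hbc with h2 | h2
        · exact absurd ⟨fun h => by linarith, fun h => by linarith⟩ hs
        · exact mul_neg_of_neg_of_pos h1 h2
        · exact mul_neg_of_pos_of_neg h1 h2
        · exact absurd ⟨fun _ => h2, fun _ => h1⟩ hs
      have key : ∀ t ≤ τ a, 0 < (q * (X - C ((τ a + τ c) / 2))).eval t * b a := fun t h => by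
        have h1 := ht t (by linarith)
        have h2 : t - (τ a + τ c) / 2 < 0 := by linarith
        have h3 : 0 < (q.eval t * b c) * ((t - (τ a + τ c) / 2) * (b a * b c)) :=
          mul_pos h1 (mul_pos_of_neg_of_neg h2 hopp)
        have h4 : 0 < b c * b c := mul_self_pos.2 hbc
        simp only [eval_mul, eval_sub, eval_X, eval_C]
        refine pos_of_mul_pos_left (b := b c * b c) ?_ h4.le
        linarith
      refine ⟨q * (X - C ((τ a + τ c) / 2)), ?_, ?_, key⟩
      · have h1 : signJump (fun e => decide (0 < b e)) a c = 1 := by simp [signJump, hs]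
        have h2 : (q * (X - C ((τ a + τ c) / 2))).natDegree ≤ q.natDegree + 1 :=
          natDegree_mul_le.trans (by rw [natDegree_X_sub_C])
        rw [h1]
        have : ((q * (X - C ((τ a + τ c) / 2))).natDegree : ℤ) ≤ q.natDegree + 1 := by
          exact_mod_cast h2
        linarith
      · intro e he
        rcases List.mem_cons.1 he with rfl | he
        · exact key _ le_rfl
        · have h1 := hq e he
          have h2 : τ c ≤ τ e := by
            rcases List.mem_cons.1 he with rfl | he
            · exact le_rfl
            · exact ((List.pairwise_cons.1 hτ.2).1 e he).le
          simp only [eval_mul, eval_sub, eval_X, eval_C]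
          have : 0 < (q.eval (τ e) * b e) * (τ e - (τ a + τ c) / 2) :=
            mul_pos h1 (by linarith)
          convert this using 1; ring

open Polynomial in
/-- Weights whose first three moments vanish change sign at least three times. -/
theorem three_le_adjSum_signJump {E : Type*} (τ b : E → ℝ) {l : List E} (hl : l ≠ [])
    (hτ : l.Pairwise fun e f => τ e < τ f) (hb : ∀ e ∈ l, b e ≠ 0)
    (h0 : (l.map b).sum = 0) (h1 : (l.map fun e => b e * τ e).sum = 0)
    (h2 : (l.map fun e => b e * τ e ^ 2).sum = 0) :
    3 ≤ adjSum (signJump fun e => decide (0 < b e)) l := by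
  obtain ⟨a, l, rfl⟩ := List.exists_cons_of_ne_nil hl
  obtain ⟨q, hd, hq, -⟩ := exists_polynomial_sign τ b a l hτ hb
  by_contra! hlt
  have hdeg : q.natDegree < 3 := by
    have : (q.natDegree : ℤ) < 3 := by linarith
    exact_mod_cast this
  have hsum : ((a :: l).map fun e => q.eval (τ e) * b e).sum = 0 := by
    have : ((a :: l).map fun e => q.eval (τ e) * b e) =
        (a :: l).map fun e => q.coeff 0 * b e + q.coeff 1 * (b e * τ e) +
          q.coeff 2 * (b e * τ e ^ 2) := by
      congr 1; ext e
      rw [eval_eq_sum_range' hdeg, Finset.sum_range_succ, Finset.sum_range_succ,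
        Finset.sum_range_one]
      ring
    rw [this, List.sum_map_add, List.sum_map_add, List.sum_map_mul_left, List.sum_map_mul_left,
      List.sum_map_mul_left, h0, h1, h2]
    simp
  have hpos : 0 < ((a :: l).map fun e => q.eval (τ e) * b e).sum := by
    apply List.sum_pos
    · intro x hx
      obtain ⟨e, he, rfl⟩ := List.mem_map.1 hx
      exact hq e he
    · simp
  linarith

/-- Two crossing segments joining the centers of tangent disks of a packing cannot have four
different ends. -/
theorem not_crossing_of_disjoint {x₁ y₁ x₂ y₂ x₃ y₃ x₄ y₄ r₁ r₂ r₃ r₄ s t : ℝ}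
    (h₁ : 0 < r₁) (h₂ : 0 < r₂) (h₃ : 0 < r₃) (h₄ : 0 < r₄)
    (hs : 0 < s) (hs' : s < 1) (ht : 0 ≤ t) (ht' : t ≤ 1)
    (h12 : (x₁ - x₂) ^ 2 + (y₁ - y₂) ^ 2 = (r₁ + r₂) ^ 2)
    (h34 : (x₃ - x₄) ^ 2 + (y₃ - y₄) ^ 2 = (r₃ + r₄) ^ 2)
    (h13 : (r₁ + r₃) ^ 2 ≤ (x₁ - x₃) ^ 2 + (y₁ - y₃) ^ 2)
    (h14 : (r₁ + r₄) ^ 2 ≤ (x₁ - x₄) ^ 2 + (y₁ - y₄) ^ 2)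
    (h23 : (r₂ + r₃) ^ 2 ≤ (x₂ - x₃) ^ 2 + (y₂ - y₃) ^ 2)
    (h24 : (r₂ + r₄) ^ 2 ≤ (x₂ - x₄) ^ 2 + (y₂ - y₄) ^ 2)
    (hx : (1 - s) * x₁ + s * x₂ = (1 - t) * x₃ + t * x₄)
    (hy : (1 - s) * y₁ + s * y₂ = (1 - t) * y₃ + t * y₄) : False := by
  have e13 := mul_le_mul_of_nonneg_left h13 (mul_nonneg (sub_nonneg.2 hs'.le) (sub_nonneg.2 ht'))
  have e14 := mul_le_mul_of_nonneg_left h14 (mul_nonneg (sub_nonneg.2 hs'.le) ht)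
  have e23 := mul_le_mul_of_nonneg_left h23 (mul_nonneg hs.le (sub_nonneg.2 ht'))
  have e24 := mul_le_mul_of_nonneg_left h24 (mul_nonneg hs.le ht)
  have key : (1 - s) * (1 - t) * ((x₁ - x₃) ^ 2 + (y₁ - y₃) ^ 2) +
      (1 - s) * t * ((x₁ - x₄) ^ 2 + (y₁ - y₄) ^ 2) +
      s * (1 - t) * ((x₂ - x₃) ^ 2 + (y₂ - y₃) ^ 2) +
      s * t * ((x₂ - x₄) ^ 2 + (y₂ - y₄) ^ 2) =
      s * (1 - s) * (r₁ + r₂) ^ 2 + t * (1 - t) * (r₃ + r₄) ^ 2 := by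
    rw [← h12, ← h34, ← sub_eq_zero]
    have hx' := sub_eq_zero.2 hx
    have hy' := sub_eq_zero.2 hy
    trans ((1 - s) * x₁ + s * x₂ - ((1 - t) * x₃ + t * x₄)) ^ 2 +
      ((1 - s) * y₁ + s * y₂ - ((1 - t) * y₃ + t * y₄)) ^ 2
    · ring
    · rw [hx', hy']; ring
  have p1 : 0 < (1 - s) * r₁ + s * r₂ := by
    have := mul_pos hs h₂; have := mul_pos (sub_pos.2 hs') h₁; linarith
  have p2 : 0 < (1 - t) * r₃ + t * r₄ := by
    rcases ht.eq_or_lt with rfl | h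
    · linarith
    · have := mul_pos h h₄; have := mul_nonneg (sub_nonneg.2 ht') h₃.le; linarith
  have p3 := mul_pos p1 p2
  linarith [sq_nonneg ((1 - s) * r₁ - s * r₂), sq_nonneg ((1 - t) * r₃ - t * r₄)]

/-- Two different edges of a contact graph that share an end do not meet elsewhere. -/
theorem not_crossing_of_common_end {x₁ y₁ x₂ y₂ x₄ y₄ r₁ r₂ r₄ s t : ℝ}
    (h₂ : 0 < r₂) (h₄ : 0 < r₄) (hs : 0 < s) (ht : 0 < t)
    (h12 : (x₁ - x₂) ^ 2 + (y₁ - y₂) ^ 2 = (r₁ + r₂) ^ 2)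
    (h14 : (x₁ - x₄) ^ 2 + (y₁ - y₄) ^ 2 = (r₁ + r₄) ^ 2)
    (h24 : (r₂ + r₄) ^ 2 ≤ (x₂ - x₄) ^ 2 + (y₂ - y₄) ^ 2)
    (hx : (1 - s) * x₁ + s * x₂ = (1 - t) * x₁ + t * x₄)
    (hy : (1 - s) * y₁ + s * y₂ = (1 - t) * y₁ + t * y₄) : False := by
  have e24 := mul_le_mul_of_nonneg_left h24 (mul_nonneg hs.le ht.le)
  have key : (1 - s) * t * (r₁ + r₄) ^ 2 +
      s * (1 - t) * (r₁ + r₂) ^ 2 +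
      s * t * ((x₂ - x₄) ^ 2 + (y₂ - y₄) ^ 2) =
      s * (1 - s) * (r₁ + r₂) ^ 2 + t * (1 - t) * (r₁ + r₄) ^ 2 := by
    rw [← h12, ← h14]
    linear_combination ((1 - s) * x₁ + s * x₂ - ((1 - t) * x₁ + t * x₄)) * hx +
      ((1 - s) * y₁ + s * y₂ - ((1 - t) * y₁ + t * y₄)) * hy
  have p3 := mul_pos (mul_pos hs h₂) (mul_pos ht h₄)
  nlinarith [sq_nonneg ((1 - s) * r₁ - s * r₂ - (1 - t) * r₁ + t * r₄)]

/-- A stress `ω` on the contact graph of a planar packing of disks with centers `(x i, y i)` and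
radii `r i` which is in equilibrium and also balanced when weighted by the lengths of the edges.
The abscissas of the centers are assumed to be distinct. -/
structure IsBalancedStress {ι : Type*} [Fintype ι] (x y r : ι → ℝ) (ω : ι → ι → ℝ) : Prop where
  injective : Function.Injective x
  pos : ∀ i, 0 < r i
  separated : ∀ i j, i ≠ j → (r i + r j) ^ 2 ≤ (x i - x j) ^ 2 + (y i - y j) ^ 2
  contact : ∀ i j, ω i j ≠ 0 → i ≠ j ∧ (x i - x j) ^ 2 + (y i - y j) ^ 2 = (r i + r j) ^ 2
  symm : ∀ i j, ω i j = ω j i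
  sum_x : ∀ i, ∑ j, ω i j * (x j - x i) = 0
  sum_y : ∀ i, ∑ j, ω i j * (y j - y i) = 0
  sum_r : ∀ i, ∑ j, ω i j * (r i + r j) = 0

section sweep
variable {ι : Type*} (x y : ι → ℝ) (ω : ι → ι → ℝ)

/-- The slope of the segment between two points. -/
noncomputable def edgeSlope (e : ι × ι) : ℝ := (y e.2 - y e.1) / (x e.2 - x e.1)

/-- The height at abscissa `X` of the line through two points. -/
noncomputable def edgeHeight (e : ι × ι) (X : ℝ) : ℝ := y e.1 + edgeSlope x y e * (X - x e.1)

/-- A pair of vertices, ordered from left to right, that carries a nonzero stress. -/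
def IsStressedEdge (e : ι × ι) : Prop := x e.1 < x e.2 ∧ ω e.1 e.2 ≠ 0

/-- The segment `e` is below the segment `f` wherever both are defined. -/
def EdgeBelow (e f : ι × ι) : Prop :=
  ∀ X, x e.1 < X → X < x e.2 → x f.1 < X → X < x f.2 → edgeHeight x y e X < edgeHeight x y f X

variable {x y ω}

theorem edgeHeight_left (e : ι × ι) : edgeHeight x y e (x e.1) = y e.1 := by simp [edgeHeight]

theorem edgeHeight_right {e : ι × ι} (h : x e.1 < x e.2) :
    edgeHeight x y e (x e.2) = y e.2 := by
  have : x e.2 - x e.1 ≠ 0 := by linarith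
  simp [edgeHeight, edgeSlope, this]

theorem continuous_edgeHeight (e : ι × ι) : Continuous (edgeHeight x y e) := by
  unfold edgeHeight; fun_prop

theorem exists_edge_param {e : ι × ι} {X : ℝ} (h1 : x e.1 < X) (h2 : X < x e.2) :
    ∃ s, 0 < s ∧ s < 1 ∧ (1 - s) * x e.1 + s * x e.2 = X ∧
      (1 - s) * y e.1 + s * y e.2 = edgeHeight x y e X := by
  have h : 0 < x e.2 - x e.1 := by linarith
  refine ⟨(X - x e.1) / (x e.2 - x e.1), div_pos (by linarith) h, ?_, ?_, ?_⟩
  · rw [div_lt_one h]; linarith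
  · field_simp; ring
  · unfold edgeHeight edgeSlope; field_simp; ring

theorem not_edgeBelow_self {e : ι × ι} (h : x e.1 < x e.2) : ¬ EdgeBelow x y e e := fun hb =>
  lt_irrefl _ (hb ((x e.1 + x e.2) / 2) (by linarith) (by linarith) (by linarith) (by linarith))

variable [Fintype ι] {r : ι → ℝ} (H : IsBalancedStress x y r ω)
include H

theorem IsBalancedStress.edge_eq {e f : ι × ι} (he : IsStressedEdge x ω e)
    (hf : IsStressedEdge x ω f) {X : ℝ} (h1 : x e.1 < X) (h2 : X < x e.2) (h3 : x f.1 < X)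
    (h4 : X < x f.2) (h : edgeHeight x y e X = edgeHeight x y f X) : e = f := by
  obtain ⟨s, hs, hs', hsx, hsy⟩ := exists_edge_param (y := y) h1 h2
  obtain ⟨t, ht, ht', htx, hty⟩ := exists_edge_param (y := y) h3 h4
  obtain ⟨a, b⟩ := e
  obtain ⟨c, d⟩ := f
  obtain ⟨-, he⟩ := H.contact _ _ he.2
  obtain ⟨-, hf⟩ := H.contact _ _ hf.2
  simp only at *
  have had : a ≠ d := by rintro rfl; linarith
  have hbc : b ≠ c := by rintro rfl; linarith
  by_cases hac : a = c
  · subst hac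
    by_cases hbd : b = d
    · rw [hbd]
    · exact (not_crossing_of_common_end (H.pos b) (H.pos d) hs ht he hf
        (H.separated _ _ hbd) (hsx.trans htx.symm) (by rw [hsy, hty, h])).elim
  · by_cases hbd : b = d
    · subst hbd
      exact (not_crossing_of_common_end (x₁ := x b) (y₁ := y b) (r₁ := r b) (s := 1 - s)
        (t := 1 - t) (H.pos a) (H.pos c) (by linarith) (by linarith) (by linarith)
        (by linarith) (H.separated _ _ hac) (by linarith)
        (by linarith)).elim
    · exact (not_crossing_of_disjoint (H.pos a) (H.pos b) (H.pos c) (H.pos d) hs hs' ht.le ht'.le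
        he hf (H.separated _ _ hac) (H.separated _ _ had) (H.separated _ _ hbc)
        (H.separated _ _ hbd) (hsx.trans htx.symm) (by rw [hsy, hty, h])).elim

theorem IsBalancedStress.edgeHeight_ne {e : ι × ι} (he : IsStressedEdge x ω e) {v : ι}
    (h1 : x e.1 < x v) (h2 : x v < x e.2) : edgeHeight x y e (x v) ≠ y v := by
  intro h
  obtain ⟨s, hs, hs', hsx, hsy⟩ := exists_edge_param (y := y) h1 h2
  obtain ⟨a, b⟩ := e
  obtain ⟨-, he⟩ := H.contact _ _ he.2
  simp only at *
  have hav := H.separated a v (by rintro rfl; linarith)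
  have hbv := H.separated b v (by rintro rfl; linarith)
  have e1 := mul_le_mul_of_nonneg_left hav (sub_nonneg.2 hs'.le)
  have e2 := mul_le_mul_of_nonneg_left hbv hs.le
  have key : (1 - s) * ((x a - x v) ^ 2 + (y a - y v) ^ 2) +
      s * ((x b - x v) ^ 2 + (y b - y v) ^ 2) = s * (1 - s) * (r a + r b) ^ 2 := by
    rw [← he]
    linear_combination ((1 - s) * x a + s * x b - x v) * hsx +
      ((1 - s) * y a + s * y b - y v) * (hsy.trans h)
  have p1 : 0 < (1 - s) * r a + s * r b := by
    have := mul_pos hs (H.pos b); have := mul_pos (sub_pos.2 hs') (H.pos a); linarith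
  have p3 := mul_pos p1 (H.pos v)
  nlinarith [sq_nonneg ((1 - s) * r a - s * r b), sq_nonneg (r v)]

theorem IsBalancedStress.edgeBelow {e f : ι × ι} (he : IsStressedEdge x ω e)
    (hf : IsStressedEdge x ω f) {X : ℝ} (h1 : x e.1 ≤ X) (h2 : X ≤ x e.2) (h3 : x f.1 ≤ X)
    (h4 : X ≤ x f.2) (h : edgeHeight x y e X < edgeHeight x y f X) : EdgeBelow x y e f := by
  intro Z g1 g2 g3 g4
  by_contra! hZ
  have hc : ContinuousOn (fun X => edgeHeight x y e X - edgeHeight x y f X) (Set.uIcc X Z) :=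
    ((continuous_edgeHeight e).sub (continuous_edgeHeight f)).continuousOn
  obtain ⟨W, hW, hW0⟩ := intermediate_value_uIcc hc
    (show (0 : ℝ) ∈ _ from Set.mem_uIcc.2 (Or.inl ⟨by linarith, by linarith⟩))
  have hWX : W ≠ X := by rintro rfl; simp only at hW0; linarith
  have hef : e = f := by
    rcases Set.mem_uIcc.1 hW with ⟨k1, k2⟩ | ⟨k1, k2⟩
    · have := lt_of_le_of_ne k1 hWX.symm
      exact H.edge_eq he hf (X := W) (by linarith) (by linarith) (by linarith) (by linarith)
        (by linarith)
    · have := lt_of_le_of_ne k2 hWX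
      exact H.edge_eq he hf (X := W) (by linarith) (by linarith) (by linarith) (by linarith)
        (by linarith)
  rw [hef] at h
  exact lt_irrefl _ h

theorem IsBalancedStress.edgeHeight_le {e f : ι × ι} (he : IsStressedEdge x ω e)
    (hf : IsStressedEdge x ω f) {X : ℝ} (h1 : x e.1 < X) (h2 : X ≤ x e.2) (h3 : x f.1 < X)
    (h4 : X ≤ x f.2) (h : EdgeBelow x y e f) : edgeHeight x y e X ≤ edgeHeight x y f X := by
  by_contra! hlt
  have h5 := H.edgeBelow hf he h3.le h4 h1.le h2 hlt
  have h6 : max (x e.1) (x f.1) < X := max_lt h1 h3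
  obtain ⟨Z, hZ, hZ'⟩ := exists_between h6
  obtain ⟨hZ1, hZ2⟩ := max_lt_iff.1 hZ
  exact lt_asymm (h Z hZ1 (by linarith) hZ2 (by linarith))
    (h5 Z hZ2 (by linarith) hZ1 (by linarith))

end sweep

theorem exists_list_pairwise_lt {E : Type*} [DecidableEq E] (k : E → ℝ) (s : Finset E)
    (hk : ∀ e ∈ s, ∀ f ∈ s, k e = k f → e = f) :
    ∃ l : List E, (∀ e, e ∈ l ↔ e ∈ s) ∧ l.Pairwise fun e f => k e < k f := by
  induction s using Finset.induction_on_max_value k with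
  | empty => exact ⟨[], by simp, by simp⟩
  | insert a s ha hmax ih =>
    obtain ⟨l, hl, hp⟩ := ih fun e he f hf => hk e (by simp [he]) f (by simp [hf])
    refine ⟨l ++ [a], fun e => by simp [hl, or_comm], ?_⟩
    rw [List.pairwise_append]
    refine ⟨hp, by simp, fun e he f hf => ?_⟩
    rw [List.mem_singleton.1 hf]
    have hes := (hl e).1 he
    refine lt_of_le_of_ne (hmax e hes) fun h => ha ?_
    rw [← hk e (by simp [hes]) a (by simp) h]
    exact hes

theorem filter_append_of_pairwise_le {E : Type*} (k : E → ℝ) (c : ℝ) {l : List E}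
    (hl : l.Pairwise fun e f => k e ≤ k f) :
    l.filter (k · < c) ++ l.filter (k · = c) ++ l.filter (c < k ·) = l := by
  induction l with
  | nil => rfl
  | cons a l ih =>
    rw [List.pairwise_cons] at hl
    have ih := ih hl.2
    rcases lt_trichotomy (k a) c with h | h | h
    · simpa [h, h.ne, h.not_gt] using ih
    · have h1 : l.filter (k · < c) = [] := by
        rw [List.filter_eq_nil_iff]
        intro e he
        have := hl.1 e he
        simp; linarith
      rw [h1] at ih
      simpa [h, h1] using ih
    · have h1 : l.filter (k · < c) = [] := by
        rw [List.filter_eq_nil_iff]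
        intro e he
        have := hl.1 e he
        simp; linarith
      have h2 : l.filter (k · = c) = [] := by
        rw [List.filter_eq_nil_iff]
        intro e he
        have := hl.1 e he
        simp; intro h; linarith
      rw [h1, h2] at ih
      simpa [h, h1, h2, h.ne', h.not_gt] using ih

theorem add_sqrt_one_add_sq_strictMono : StrictMono fun s : ℝ => s + √(1 + s ^ 2) := by
  intro s t h
  simp only [← Real.exp_arsinh]
  exact Real.exp_lt_exp.2 (Real.arsinh_lt_arsinh.2 h)

theorem sub_sqrt_one_add_sq_strictMono : StrictMono fun s : ℝ => s - √(1 + s ^ 2) := by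
  intro s t h
  have := add_sqrt_one_add_sq_strictMono (neg_lt_neg h)
  simp only [neg_sq] at this ⊢
  linarith

theorem sub_sqrt_lt_add_sqrt (s t : ℝ) : s - √(1 + s ^ 2) < t + √(1 + t ^ 2) := by
  have h1 : |s| < √(1 + s ^ 2) := by
    rw [← Real.sqrt_sq_eq_abs]
    exact Real.sqrt_lt_sqrt (sq_nonneg _) (by linarith)
  have h2 : |t| < √(1 + t ^ 2) := by
    rw [← Real.sqrt_sq_eq_abs]
    exact Real.sqrt_lt_sqrt (sq_nonneg _) (by linarith)
  linarith [le_abs_self s, neg_abs_le t]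

theorem edgeHeight_eq_right {ι : Type*} {x y : ι → ℝ} {e : ι × ι} (h : x e.1 < x e.2) (Z : ℝ) :
    edgeHeight x y e Z = y e.2 + edgeSlope x y e * (Z - x e.2) := by
  rw [← edgeHeight_right (y := y) h, edgeHeight, edgeHeight]; ring

/-- A coordinate on the edges at `v` that increases clockwise along the left edges, and then
counterclockwise along the right edges. -/
noncomputable def edgeAngle {ι : Type*} [DecidableEq ι] (x y : ι → ℝ) (v : ι) (e : ι × ι) : ℝ :=
  if e.1 = v then edgeSlope x y e + √(1 + edgeSlope x y e ^ 2)
  else edgeSlope x y e - √(1 + edgeSlope x y e ^ 2)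

theorem edge_moment {d u l q s : ℝ} (hq : q ^ 2 = 1 + s ^ 2) (hu : s * d = u) (hl : l = d * q) :
    (l - u) * (s + q) = d ∧ d * (s + q) = l + u := by
  subst hu hl
  exact ⟨by linear_combination d * hq, by ring⟩

section
variable {ι : Type*} [Fintype ι] [DecidableEq ι] {x y r : ι → ℝ} {ω : ι → ι → ℝ}

theorem IsBalancedStress.three_le_signJump (H : IsBalancedStress x y r ω) (v : ι)
    {W : List (ι × ι)} (hne : W ≠ [])
    (hmem : ∀ e, e ∈ W ↔ IsStressedEdge x ω e ∧ (e.1 = v ∨ e.2 = v))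
    (hτ : W.Pairwise fun e f => edgeAngle x y v e < edgeAngle x y v f) :
    3 ≤ adjSum (signJump fun e : ι × ι => decide (0 < ω e.1 e.2)) W := by
  let o : ι × ι → ι := fun e => if e.1 = v then e.2 else e.1
  let b : ι × ι → ℝ := fun e => ω v (o e) * (r v + r (o e) - (y (o e) - y v))
  have hcase : ∀ e ∈ W, e.1 = v ∧ o e = e.2 ∨ e.2 = v ∧ o e = e.1 := by
    intro e he
    rcases ((hmem e).1 he).2 with h | h
    · exact Or.inl ⟨h, if_pos h⟩
    · refine Or.inr ⟨h, if_neg fun h2 => ?_⟩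
      have := ((hmem e).1 he).1.1
      rw [h, h2] at this
      exact lt_irrefl _ this
  have ho : ∀ e ∈ W, ω e.1 e.2 = ω v (o e) := by
    intro e he
    rcases hcase e he with ⟨h1, h2⟩ | ⟨h1, h2⟩
    · rw [h2, h1]
    · rw [h2, h1, H.symm]
  have hcontact : ∀ e ∈ W, (x (o e) - x v) ^ 2 + (y (o e) - y v) ^ 2 = (r v + r (o e)) ^ 2 := by
    intro e he
    have h1 := ((hmem e).1 he).1.2
    rw [ho e he] at h1
    rw [← (H.contact _ _ h1).2]; ring
  have hxv : ∀ e ∈ W, x (o e) ≠ x v := by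
    intro e he h
    have h1 := ((hmem e).1 he).1.2
    rw [ho e he] at h1
    exact (H.contact _ _ h1).1 (H.injective h.symm)
  have hpos : ∀ e ∈ W, 0 < r v + r (o e) - (y (o e) - y v) := by
    intro e he
    have h1 := hcontact e he
    have h2 : 0 < (x (o e) - x v) ^ 2 := by
      have := sub_ne_zero.2 (hxv e he); positivity
    have h3 : |y (o e) - y v| < |r v + r (o e)| := sq_lt_sq.1 (by linarith)
    rw [abs_of_pos (add_pos (H.pos _) (H.pos _))] at h3
    linarith [le_abs_self (y (o e) - y v)]
  have hang : ∀ e ∈ W, (r v + r (o e) - (y (o e) - y v)) * edgeAngle x y v e = x (o e) - x v ∧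
      (x (o e) - x v) * edgeAngle x y v e = r v + r (o e) + (y (o e) - y v) := by
    intro e he
    have hsq : √(1 + edgeSlope x y e ^ 2) ^ 2 = 1 + edgeSlope x y e ^ 2 :=
      Real.sq_sqrt (by positivity)
    have hnn := Real.sqrt_nonneg (1 + edgeSlope x y e ^ 2)
    have hlt := ((hmem e).1 he).1.1
    have hsl : edgeSlope x y e * (x e.2 - x e.1) = y e.2 - y e.1 := by
      have : x e.2 - x e.1 ≠ 0 := by linarith
      unfold edgeSlope; field_simp
    have hc := hcontact e he
    have hrp : 0 < r v + r (o e) := add_pos (H.pos _) (H.pos _)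
    unfold edgeAngle
    generalize √(1 + edgeSlope x y e ^ 2) = q at *
    generalize edgeSlope x y e = s at *
    by_cases h : e.1 = v
    · have hoe : o e = e.2 := by simp [o, h]
      rw [if_pos h]
      rw [hoe] at hc hrp ⊢
      rw [h] at hsl hlt
      refine edge_moment hsq hsl ((pow_left_inj₀ hrp.le
        (mul_nonneg (by linarith) hnn) two_ne_zero).1 ?_)
      rw [← hc, ← hsl]
      linear_combination -(x e.2 - x v) ^ 2 * hsq
    · have hoe : o e = e.1 := by simp [o, h]
      have h2 : e.2 = v := ((hmem e).1 he).2.resolve_left h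
      rw [if_neg h, sub_eq_add_neg s q]
      rw [hoe] at hc hrp ⊢
      rw [h2] at hsl hlt
      have hsl' : s * (x e.1 - x v) = y e.1 - y v := by linarith
      have : (x e.1 - x v) * -q = (x v - x e.1) * q := by ring
      refine edge_moment (by rw [neg_sq, hsq]) hsl' ((pow_left_inj₀ hrp.le
        (by rw [this]; exact mul_nonneg (by linarith) hnn) two_ne_zero).1 ?_)
      rw [← hc, ← hsl']
      linear_combination -(x e.1 - x v) ^ 2 * hsq
  have hnodup : (W.map o).Nodup := by
    refine List.Nodup.map_on ?_ (hτ.imp fun h heq => by rw [heq] at h; exact lt_irrefl _ h)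
    intro e he f hf hef
    have h1 := ((hmem e).1 he).1.1
    have h2 := ((hmem f).1 hf).1.1
    rcases hcase e he with ⟨a1, a2⟩ | ⟨a1, a2⟩ <;> rcases hcase f hf with ⟨b1, b2⟩ | ⟨b1, b2⟩ <;>
      rw [a2, b2] at hef
    · exact Prod.ext (a1.trans b1.symm) hef
    · rw [a1, hef] at h1; rw [b1] at h2; exact (lt_asymm h1 h2).elim
    · rw [a1, hef] at h1; rw [b1] at h2; exact (lt_asymm h1 h2).elim
    · exact Prod.ext hef (a1.trans b1.symm)
  have hsum : ∀ g : ι → ℝ, (W.map fun e => ω v (o e) * g (o e)).sum = ∑ j, ω v j * g j := by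
    intro g
    have h1 : (W.map fun e => ω v (o e) * g (o e)) = (W.map o).map fun j => ω v j * g j := by
      simp
    rw [h1, ← List.sum_toFinset _ hnodup]
    refine Finset.sum_subset (Finset.subset_univ _) fun j _ hj => ?_
    by_contra h
    have hvj := left_ne_zero_of_mul h
    apply hj
    rw [List.mem_toFinset, List.mem_map]
    have hne := (H.contact _ _ hvj).1
    rcases lt_or_gt_of_ne (H.injective.ne hne) with h2 | h2
    · exact ⟨(v, j), (hmem _).2 ⟨⟨h2, hvj⟩, Or.inl rfl⟩, by simp [o]⟩
    · exact ⟨(j, v), (hmem _).2 ⟨⟨h2, by rwa [H.symm j v]⟩, Or.inr rfl⟩, by simp [o, hne.symm]⟩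
  have hsx := H.sum_x v
  have hsy := H.sum_y v
  have hsr := H.sum_r v
  have hb0 : ∀ e ∈ W, b e ≠ 0 := fun e he =>
    mul_ne_zero (by rw [← ho e he]; exact ((hmem e).1 he).1.2) (hpos e he).ne'
  have key := three_le_adjSum_signJump (edgeAngle x y v) b hne hτ hb0 ?_ ?_ ?_
  · convert key using 1
    refine adjSum_congr (List.pairwise_of_forall_mem_list fun e he f hf => ?_)
    simp only [signJump, ho e he, ho f hf, b, mul_pos_iff_of_pos_right (hpos e he),
      mul_pos_iff_of_pos_right (hpos f hf)]
  · rw [hsum fun j => r v + r j - (y j - y v)]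
    simp only [mul_sub (ω v _) (r v + _), Finset.sum_sub_distrib, hsr, hsy, sub_zero]
  · rw [← hsx, ← hsum]
    congr 1
    refine List.map_congr_left fun e he => ?_
    rw [← (hang e he).1]; ring
  · have : (W.map fun e => b e * edgeAngle x y v e ^ 2) =
        W.map fun e => ω v (o e) * (r v + r (o e) + (y (o e) - y v)) := by
      refine List.map_congr_left fun e he => ?_
      rw [← (hang e he).2, ← (hang e he).1]; ring
    rw [this, hsum fun j => r v + r j + (y j - y v)]
    simp only [mul_add (ω v _) (r v + _), Finset.sum_add_distrib, hsr, hsy, add_zero]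

theorem IsBalancedStress.exists_list_sweep (H : IsBalancedStress x y r ω) (S : Finset ι)
    (hS : ∀ i ∈ S, ∀ j ∉ S, x i < x j) :
    ∃ l : List (ι × ι), (∀ e, e ∈ l ↔ IsStressedEdge x ω e ∧ e.1 ∈ S ∧ e.2 ∉ S) ∧
      l.Pairwise (EdgeBelow x y) ∧ ((∀ e, IsStressedEdge x ω e → e.1 ∉ S) ∨
        1 ≤ adjSum (signedJump (fun e : ι × ι => decide (0 < ω e.1 e.2)) Prod.fst) l) := by
  induction S using Finset.induction_on_max_value x with
  | empty => exact ⟨[], by simp, by simp, by simp⟩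
  | insert v S hv hmax ih =>
    have hSv : ∀ i ∈ S, x i < x v := fun i hi =>
      lt_of_le_of_ne (hmax i hi) (H.injective.ne (by rintro rfl; exact hv hi))
    have hvS : ∀ j, j ∉ S → j ≠ v → x v < x j := fun j hj hjv =>
      hS v (by simp) j (by simp [hj, hjv])
    obtain ⟨l, hl, hpw, hcount⟩ := ih fun i hi j hj => by
      by_cases h : j = v
      · rw [h]; exact hSv i hi
      · exact hS i (by simp [hi]) j (by simp [hj, h])
    have hle : ∀ e ∈ l, x e.1 < x v ∧ x v ≤ x e.2 := fun e he => by
      obtain ⟨h1, h2, h3⟩ := (hl e).1 he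
      refine ⟨hSv _ h2, ?_⟩
      by_cases h : e.2 = v
      · rw [h]
      · exact (hvS _ h3 h).le
    have hmono : l.Pairwise fun e f => edgeHeight x y e (x v) ≤ edgeHeight x y f (x v) :=
      hpw.imp_of_mem fun {e f} he hf hef => H.edgeHeight_le ((hl e).1 he).1 ((hl f).1 hf).1
        (hle e he).1 (hle e he).2 (hle f hf).1 (hle f hf).2 hef
    have hheq : ∀ e ∈ l, edgeHeight x y e (x v) = y v ↔ e.2 = v := fun e he => by
      constructor
      · intro h
        by_contra h2
        exact H.edgeHeight_ne ((hl e).1 he).1 (hle e he).1 (hvS _ ((hl e).1 he).2.2 h2) h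
      · rintro rfl
        exact edgeHeight_right ((hl e).1 he).1.1
    have hsplit := filter_append_of_pairwise_le (fun e => edgeHeight x y e (x v)) (y v) hmono
    have hAmem : ∀ e, e ∈ l.filter (edgeHeight x y · (x v) < y v) ↔
        e ∈ l ∧ edgeHeight x y e (x v) < y v := fun e => by simp
    have hBmem : ∀ e, e ∈ l.filter (y v < edgeHeight x y · (x v)) ↔
        e ∈ l ∧ y v < edgeHeight x y e (x v) := fun e => by simp
    have hLmem : ∀ e, e ∈ l.filter (edgeHeight x y · (x v) = y v) ↔ e ∈ l ∧ e.2 = v :=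
      fun e => by
        rw [List.mem_filter, decide_eq_true_iff]
        exact and_congr_right fun he => hheq e he
    generalize l.filter (edgeHeight x y · (x v) < y v) = A at hsplit hAmem
    generalize l.filter (edgeHeight x y · (x v) = y v) = L at hsplit hLmem
    generalize l.filter (y v < edgeHeight x y · (x v)) = B at hsplit hBmem
    classical
    obtain ⟨R, hRmem, hRpw⟩ := exists_list_pairwise_lt (edgeSlope x y)
      {e : ι × ι | IsStressedEdge x ω e ∧ e.1 = v} (by
        intro e he f hf hef
        simp only [Finset.mem_filter, Finset.mem_univ, true_and] at he hf
        obtain ⟨Z, hZ, hZ'⟩ := exists_between (lt_min he.1.1 (show x e.1 < x f.2 by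
          rw [he.2, ← hf.2]; exact hf.1.1))
        obtain ⟨h1, h2⟩ := lt_min_iff.1 hZ'
        have h3 : f.1 = e.1 := hf.2.trans he.2.symm
        refine H.edge_eq he.1 hf.1 hZ h1 (by rwa [h3]) h2 ?_
        rw [edgeHeight, edgeHeight, hef, h3])
    simp only [Finset.mem_filter, Finset.mem_univ, true_and] at hRmem
    have hpw' := hpw
    rw [← hsplit, List.pairwise_append, List.pairwise_append] at hpw'
    obtain ⟨⟨hA, hLpw, -⟩, hB, hAB⟩ := hpw'
    refine ⟨A ++ R ++ B, fun e => ?_, ?_, ?_⟩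
    · simp only [List.mem_append, hAmem, hBmem, hRmem, Finset.mem_insert, not_or]
      constructor
      · rintro ((⟨h1, h2⟩ | ⟨h1, h2⟩) | ⟨h1, h2⟩)
        · have h3 := (hl e).1 h1
          exact ⟨h3.1, Or.inr h3.2.1, fun h => h2.ne ((hheq e h1).2 h), h3.2.2⟩
        · have h4 : x v < x e.2 := h2 ▸ h1.1
          exact ⟨h1, Or.inl h2, fun h => by rw [h] at h4; exact lt_irrefl _ h4,
            fun h => lt_asymm h4 (hSv _ h)⟩
        · have h3 := (hl e).1 h1
          exact ⟨h3.1, Or.inr h3.2.1, fun h => h2.ne' ((hheq e h1).2 h), h3.2.2⟩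
      · rintro ⟨h1, h2 | h2, h3, h4⟩
        · exact Or.inl (Or.inr ⟨h1, h2⟩)
        · have h5 := (hl e).2 ⟨h1, h2, h4⟩
          rcases lt_or_gt_of_ne (mt (hheq e h5).1 h3) with h | h
          · exact Or.inl (Or.inl ⟨h5, h⟩)
          · exact Or.inr ⟨h5, h⟩
    · rw [List.pairwise_append, List.pairwise_append]
      have hRle : ∀ e ∈ R, x e.1 ≤ x v ∧ x v ≤ x e.2 ∧ edgeHeight x y e (x v) = y v :=
        fun e he => by
          obtain ⟨h1, rfl⟩ := (hRmem e).1 he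
          exact ⟨le_rfl, h1.1.le, edgeHeight_left e⟩
      refine ⟨⟨hA, ?_, ?_⟩, hB, ?_⟩
      · refine hRpw.imp_of_mem fun {e f} he hf hef Z h1 _ _ _ => ?_
        rw [edgeHeight, edgeHeight, ((hRmem e).1 he).2, ((hRmem f).1 hf).2]
        rw [((hRmem e).1 he).2] at h1
        have := mul_lt_mul_of_pos_right hef (sub_pos.2 h1)
        linarith
      · intro e he f hf
        obtain ⟨he1, he2⟩ := (hAmem e).1 he
        obtain ⟨hf1, hf2, hf3⟩ := hRle f hf
        exact H.edgeBelow ((hl e).1 he1).1 ((hRmem f).1 hf).1 (hle e he1).1.le (hle e he1).2 hf1 hf2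
          (by rwa [hf3])
      · intro e he f hf
        rcases List.mem_append.1 he with he | he
        · exact hAB e (List.mem_append_left _ he) f hf
        · obtain ⟨hf1, hf2⟩ := (hBmem f).1 hf
          obtain ⟨he1, he2, he3⟩ := hRle e he
          exact H.edgeBelow ((hRmem e).1 he).1 ((hl f).1 hf1).1 he1 he2 (hle f hf1).1.le
            (hle f hf1).2 (by rwa [he3])
    · by_cases hW : L.reverse ++ R = []
      · simp only [List.append_eq_nil_iff, List.reverse_eq_nil_iff] at hW
        rw [hW.2]
        rw [hW.1] at hsplit
        rw [hsplit]
        refine hcount.imp_left fun h e he => ?_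
        rw [Finset.mem_insert, not_or]
        refine ⟨fun h2 => ?_, h e he⟩
        have := (hRmem e).2 ⟨he, h2⟩
        rw [hW.2] at this
        exact absurd this (by simp)
      · right
        have hLsub : ∀ e ∈ L, e ∈ l ∧ e.2 = v := fun e he => (hLmem e).1 he
        have h3 := H.three_le_signJump v hW (fun e => ?_) ?_
        · have hlA : ∀ e ∈ l, e.1 ≠ v := fun e he h => by
            have := (hle e he).1
            rw [h] at this
            exact lt_irrefl _ this
          have hLne : L.Pairwise fun e f => e.1 ≠ f.1 := hLpw.imp_of_mem
            fun {e f} he hf hef h => by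
              have h5 : e = f := Prod.ext h ((hLsub e he).2.trans (hLsub f hf).2.symm)
              rw [← h5] at hef
              exact not_edgeBelow_self ((hl e).1 (hLsub e he).1).1.1 hef
          rcases hcount with h | h
          · have hnil : l = [] := List.eq_nil_iff_forall_not_mem.2 fun e he =>
              h e ((hl e).1 he).1 ((hl e).1 he).2.1
            rw [hnil] at hsplit
            simp only [List.append_eq_nil_iff] at hsplit
            obtain ⟨⟨rfl, rfl⟩, rfl⟩ := hsplit
            rw [List.nil_append, List.append_nil]
            rw [adjSum_congr (ψ := signJump fun e : ι × ι => decide (0 < ω e.1 e.2))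
              (List.pairwise_of_forall_mem_list fun a ha b hb => by
                simp [signedJump, ((hRmem a).1 ha).2, ((hRmem b).1 hb).2])]
            rw [List.reverse_nil, List.nil_append] at h3
            linarith
          · refine h.trans ?_
            conv_lhs => rw [← hsplit]
            exact adjSum_signedJump_le_of_vertex (v := v) (fun e he => hlA e ((hAmem e).1 he).1)
              (fun e he => hlA e ((hBmem e).1 he).1) (fun e he => ((hRmem e).1 he).2) hLne h3
        · rw [List.mem_append, List.mem_reverse, hLmem, hRmem]
          constructor
          · rintro (⟨h1, h2⟩ | ⟨h1, h2⟩)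
            · exact ⟨((hl e).1 h1).1, Or.inr h2⟩
            · exact ⟨h1, Or.inl h2⟩
          · rintro ⟨h1, h2 | h2⟩
            · exact Or.inr ⟨h1, h2⟩
            · refine Or.inl ⟨(hl e).2 ⟨h1, ?_, by rwa [h2]⟩, h2⟩
              by_contra h
              have h4 : x e.1 < x v := h2 ▸ h1.1
              by_cases h5 : e.1 = v
              · rw [h5] at h4; exact lt_irrefl _ h4
              · exact lt_asymm h4 (hvS _ h h5)
        · rw [List.pairwise_append, List.pairwise_reverse]
          refine ⟨?_, ?_, ?_⟩
          · refine hLpw.imp_of_mem fun {e f} he hf hef => ?_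
            obtain ⟨he1, he2⟩ := hLsub e he
            obtain ⟨hf1, hf2⟩ := hLsub f hf
            have he3 := (hle e he1).1
            have hf3 := (hle f hf1).1
            obtain ⟨Z, hZ, hZ'⟩ := exists_between (max_lt he3 hf3)
            obtain ⟨h4, h5⟩ := max_lt_iff.1 hZ
            have h6 := hef Z h4 (by rwa [he2]) h5 (by rwa [hf2])
            rw [edgeHeight_eq_right ((hl e).1 he1).1.1, edgeHeight_eq_right ((hl f).1 hf1).1.1,
              he2, hf2] at h6
            have h7 : edgeSlope x y f < edgeSlope x y e := by
              by_contra! h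
              have := mul_le_mul_of_nonneg_right h (sub_pos.2 hZ').le
              linarith
            have h8 : e.1 ≠ v := fun h => by rw [h] at he3; exact lt_irrefl _ he3
            have h9 : f.1 ≠ v := fun h => by rw [h] at hf3; exact lt_irrefl _ hf3
            rw [edgeAngle, edgeAngle, if_neg h8, if_neg h9]
            exact sub_sqrt_one_add_sq_strictMono h7
          · refine hRpw.imp_of_mem fun {e f} he hf hef => ?_
            rw [edgeAngle, edgeAngle, if_pos ((hRmem e).1 he).2, if_pos ((hRmem f).1 hf).2]
            exact add_sqrt_one_add_sq_strictMono hef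
          · intro e he f hf
            obtain ⟨he1, he2⟩ := hLsub e (List.mem_reverse.1 he)
            have he3 := (hle e he1).1
            have h8 : e.1 ≠ v := fun h => by rw [h] at he3; exact lt_irrefl _ he3
            rw [edgeAngle, edgeAngle, if_neg h8, if_pos ((hRmem f).1 hf).2]
            exact sub_sqrt_lt_add_sqrt _ _

/-- A packing has no nonzero balanced stress whose vertices have distinct abscissas. -/
theorem IsBalancedStress.eq_zero_of_injective (H : IsBalancedStress x y r ω) (i j : ι) :
    ω i j = 0 := by
  obtain ⟨l, hl, -, h⟩ := H.exists_list_sweep Finset.univ (by simp)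
  have hnil : l = [] := List.eq_nil_iff_forall_not_mem.2 fun e he =>
    ((hl e).1 he).2.2 (Finset.mem_univ _)
  rw [hnil] at h
  have h : ∀ e, ¬ IsStressedEdge x ω e := by simpa using h
  by_contra hij
  rcases lt_or_gt_of_ne (H.injective.ne (H.contact i j hij).1) with h1 | h1
  · exact h (i, j) ⟨h1, hij⟩
  · exact h (j, i) ⟨h1, by rwa [H.symm j i]⟩

theorem exists_forall_add_mul_ne (x y : ι → ℝ) (h : ∀ i j, i ≠ j → x i = x j → y i ≠ y j) :
    ∃ t : ℝ, Function.Injective fun i => x i + t * y i := by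
  have hfin : (⋃ e : ι × ι, {(x e.1 - x e.2) / (y e.2 - y e.1)}).Finite :=
    Set.finite_iUnion fun _ => Set.finite_singleton _
  obtain ⟨t, ht⟩ := hfin.infinite_compl.nonempty
  simp only [Set.mem_compl_iff, Set.mem_iUnion, Set.mem_singleton_iff, not_exists] at ht
  refine ⟨t, fun i j hij => ?_⟩
  simp only at hij
  by_contra hne
  by_cases hy : y j - y i = 0
  · have h1 : y i = y j := by linarith
    rw [h1] at hij
    exact h i j hne (by linarith) h1
  · refine ht (i, j) ?_
    rw [eq_div_iff hy]
    linarith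

/-- A packing of disks in the plane has no nonzero stress on its contact graph which is in
equilibrium and balanced when weighted by the lengths of the edges. -/
theorem stress_eq_zero_of_balanced (x y r : ι → ℝ) (ω : ι → ι → ℝ) (pos : ∀ i, 0 < r i)
    (separated : ∀ i j, i ≠ j → (r i + r j) ^ 2 ≤ (x i - x j) ^ 2 + (y i - y j) ^ 2)
    (contact : ∀ i j, ω i j ≠ 0 → i ≠ j ∧ (x i - x j) ^ 2 + (y i - y j) ^ 2 = (r i + r j) ^ 2)
    (symm : ∀ i j, ω i j = ω j i) (sum_x : ∀ i, ∑ j, ω i j * (x j - x i) = 0)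
    (sum_y : ∀ i, ∑ j, ω i j * (y j - y i) = 0)
    (sum_r : ∀ i, ∑ j, ω i j * (r i + r j) = 0) (i j : ι) : ω i j = 0 := by
  obtain ⟨t, ht⟩ := exists_forall_add_mul_ne x y fun i j hij hx hy => by
    have h := separated i j hij
    have := add_pos (pos i) (pos j)
    rw [hx, hy] at h
    nlinarith
  have hsq : √(1 + t ^ 2) ^ 2 = 1 + t ^ 2 := Real.sq_sqrt (by positivity)
  have hpos : 0 < √(1 + t ^ 2) := Real.sqrt_pos.2 (by positivity)
  have H : IsBalancedStress (fun i => x i + t * y i) (fun i => y i - t * x i)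
      (fun i => √(1 + t ^ 2) * r i) ω :=
    { injective := ht
      pos := fun i => mul_pos hpos (pos i)
      separated := fun i j hij => by
        have h := mul_le_mul_of_nonneg_left (separated i j hij) (sq_nonneg √(1 + t ^ 2))
        rw [hsq] at h
        calc _ = √(1 + t ^ 2) ^ 2 * (r i + r j) ^ 2 := by ring
          _ ≤ _ := by rw [hsq]; linarith
      contact := fun i j hij => by
        obtain ⟨h1, h2⟩ := contact i j hij
        refine ⟨h1, ?_⟩
        calc _ = (1 + t ^ 2) * ((x i - x j) ^ 2 + (y i - y j) ^ 2) := by ring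
          _ = √(1 + t ^ 2) ^ 2 * (r i + r j) ^ 2 := by rw [h2, hsq]
          _ = _ := by ring
      symm := symm
      sum_x := fun i => by
        calc _ = (∑ j, ω i j * (x j - x i)) + t * ∑ j, ω i j * (y j - y i) := by
              rw [Finset.mul_sum, ← Finset.sum_add_distrib]
              exact Finset.sum_congr rfl fun _ _ => by ring
          _ = 0 := by rw [sum_x, sum_y]; ring
      sum_y := fun i => by
        calc _ = (∑ j, ω i j * (y j - y i)) - t * ∑ j, ω i j * (x j - x i) := by
              rw [Finset.mul_sum, ← Finset.sum_sub_distrib]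
              exact Finset.sum_congr rfl fun _ _ => by ring
          _ = 0 := by rw [sum_x, sum_y]; ring
      sum_r := fun i => by
        calc _ = √(1 + t ^ 2) * ∑ j, ω i j * (r i + r j) := by
              rw [Finset.mul_sum]
              exact Finset.sum_congr rfl fun _ _ => by ring
          _ = 0 := by rw [sum_r, mul_zero] }
  exact H.eq_zero_of_injective i j
end

/-- The Laplacian of a graph with edge weights `ω`. -/
def weightedLaplacian {ι : Type*} [Fintype ι] (ω : ι → ι → ℝ) : (ι → ℝ) →ₗ[ℝ] (ι → ℝ) where
  toFun f i := ∑ j, ω i j * (f j - f i)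
  map_add' f g := by
    ext i
    simp only [Pi.add_apply, ← Finset.sum_add_distrib]
    exact Finset.sum_congr rfl fun _ _ => by ring
  map_smul' c f := by
    ext i
    simp only [Pi.smul_apply, smul_eq_mul, Finset.mul_sum, RingHom.id_apply]
    exact Finset.sum_congr rfl fun _ _ => by ring

theorem weightedLaplacian_apply {ι : Type*} [Fintype ι] (ω : ι → ι → ℝ) (f : ι → ℝ) (i : ι) :
    weightedLaplacian ω f i = ∑ j, ω i j * (f j - f i) := rfl

theorem weightedLaplacian_const {ι : Type*} [Fintype ι] (ω : ι → ι → ℝ) (c : ℝ) :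
    weightedLaplacian ω (fun _ => c) = 0 := by
  ext i; simp [weightedLaplacian_apply]

theorem sum_weightedLaplacian_mul_comm {ι : Type*} [Fintype ι] {ω : ι → ι → ℝ}
    (hω : ∀ i j, ω i j = ω j i) (f g : ι → ℝ) :
    ∑ i, weightedLaplacian ω f i * g i = ∑ i, weightedLaplacian ω g i * f i := by
  have h : ∀ f g : ι → ℝ, ∑ i, weightedLaplacian ω f i * g i =
      ∑ i, ∑ j, ω i j * (f j * g i) - ∑ i, ∑ j, ω i j * (f i * g i) := fun f g => by
    rw [← Finset.sum_sub_distrib]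
    refine Finset.sum_congr rfl fun i _ => ?_
    rw [weightedLaplacian_apply, Finset.sum_mul, ← Finset.sum_sub_distrib]
    exact Finset.sum_congr rfl fun _ _ => by ring
  rw [h f g, h g f, Finset.sum_comm]
  congr 1
  · exact Finset.sum_congr rfl fun i _ => Finset.sum_congr rfl fun j _ => by rw [hω]; ring
  · exact Finset.sum_congr rfl fun i _ => Finset.sum_congr rfl fun j _ => by ring

/-- If the harmonic functions on a weighted graph with boundary include a dual basis to the
boundary vertices, then adding weights between boundary vertices makes all harmonic functions
harmonic at the boundary too. -/
theorem exists_weights_extension {V B : Type*} [Fintype V] [Fintype B] [DecidableEq B]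
    {ω : V ⊕ B → V ⊕ B → ℝ} (hω : ∀ i j, ω i j = ω j i) (β : B → V ⊕ B → ℝ)
    (hβ : ∀ k i, weightedLaplacian ω (β k) (Sum.inl i) = 0)
    (hβ' : ∀ k l, β k (Sum.inr l) = if k = l then 1 else 0) :
    ∃ ω' : V ⊕ B → V ⊕ B → ℝ, (∀ i j, ω' i j = ω' j i) ∧
      (∀ i j, ω' (Sum.inl i) j = ω (Sum.inl i) j) ∧
      (∀ k, ω' (Sum.inr k) (Sum.inr k) = ω (Sum.inr k) (Sum.inr k)) ∧
      ∀ f, (∀ i, weightedLaplacian ω f (Sum.inl i) = 0) →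
        ∀ j, weightedLaplacian ω' f j = 0 := by
  have hpair : ∀ f g : V ⊕ B → ℝ, (∀ i, weightedLaplacian ω f (Sum.inl i) = 0) →
      (∀ i, weightedLaplacian ω g (Sum.inl i) = 0) →
      ∑ k, weightedLaplacian ω f (Sum.inr k) * g (Sum.inr k) =
        ∑ k, weightedLaplacian ω g (Sum.inr k) * f (Sum.inr k) := fun f g hf hg => by
    simpa [Fintype.sum_sum_type, hf, hg] using sum_weightedLaplacian_mul_comm hω f g
  have hflux : ∀ f : V ⊕ B → ℝ, (∀ i, weightedLaplacian ω f (Sum.inl i) = 0) →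
      ∀ l, weightedLaplacian ω f (Sum.inr l) =
        ∑ k, weightedLaplacian ω (β k) (Sum.inr l) * f (Sum.inr k) := fun f hf l => by
    have h1 := hpair f (β l) hf (hβ l)
    simp only [hβ', mul_ite, mul_one, mul_zero, Finset.sum_ite_eq, Finset.mem_univ, if_true] at h1
    rw [h1]
    refine Finset.sum_congr rfl fun k _ => ?_
    have h2 := hpair (β k) (β l) (hβ k) (hβ l)
    simp only [hβ', mul_ite, mul_one, mul_zero, Finset.sum_ite_eq, Finset.mem_univ, if_true] at h2
    rw [h2]
  have hsymm : ∀ k l, weightedLaplacian ω (β k) (Sum.inr l) =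
      weightedLaplacian ω (β l) (Sum.inr k) := fun k l => by
    have h2 := hpair (β k) (β l) (hβ k) (hβ l)
    simpa only [hβ', mul_ite, mul_one, mul_zero, Finset.sum_ite_eq, Finset.mem_univ, if_true]
      using h2
  let c : V ⊕ B → V ⊕ B → ℝ := Sum.elim (fun _ _ => 0) fun k => Sum.elim (fun _ => 0) fun l =>
    if k = l then 0 else weightedLaplacian ω (β l) (Sum.inr k)
  refine ⟨fun i j => ω i j - c i j, fun i j => ?_, fun i j => ?_, fun k => ?_, fun f hf j => ?_⟩
  · beta_reduce
    rw [hω i j]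
    rcases i with i | k <;> rcases j with j | l
    · rfl
    · rfl
    · rfl
    · simp only [c, Sum.elim_inr, hsymm k l, eq_comm (a := k)]
  · simp [c]
  · simp [c]
  · have h : weightedLaplacian (fun i j => ω i j - c i j) f j =
        weightedLaplacian ω f j - weightedLaplacian c f j := by
      simp only [weightedLaplacian_apply, ← Finset.sum_sub_distrib]
      exact Finset.sum_congr rfl fun _ _ => by ring
    rw [h]
    rcases j with i | l
    · rw [hf i]
      simp [weightedLaplacian_apply, c]
    · have h0 : ∑ k, weightedLaplacian ω (β k) (Sum.inr l) = 0 := by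
        have := hflux (fun _ => 1) (by simp [weightedLaplacian_const]) l
        simpa [weightedLaplacian_const] using this.symm
      have hc : weightedLaplacian c f (Sum.inr l) =
          ∑ k, weightedLaplacian ω (β k) (Sum.inr l) * (f (Sum.inr k) - f (Sum.inr l)) := by
        rw [weightedLaplacian_apply, Fintype.sum_sum_type]
        simp only [c, Sum.elim_inr, Sum.elim_inl, zero_mul, Finset.sum_const_zero, zero_add]
        refine Finset.sum_congr rfl fun k _ => ?_
        split_ifs with h
        · rw [h]; ring
        · rfl
      rw [hc, hflux f hf l]
      simp only [mul_sub, Finset.sum_sub_distrib, ← Finset.sum_mul, h0, zero_mul, sub_zero,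
        sub_self]

/-- A packing of disks, in the presence of three mutually tangent unit disks, has no nonzero stress
which, at every disk of the packing, is in equilibrium and balanced when weighted by the lengths
of the edges. -/
theorem stress_eq_zero_of_balanced_of_boundary {V : Type*} [Fintype V] [DecidableEq V]
    (x y r : V ⊕ Fin 3 → ℝ) (ω : V ⊕ Fin 3 → V ⊕ Fin 3 → ℝ) (pos : ∀ i, 0 < r i)
    (hr : ∀ k, r (Sum.inr k) = 1)
    (hside : ∀ k l, k ≠ l →
      (x (Sum.inr k) - x (Sum.inr l)) ^ 2 + (y (Sum.inr k) - y (Sum.inr l)) ^ 2 = 4)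
    (separated : ∀ i j, i ≠ j → (r i + r j) ^ 2 ≤ (x i - x j) ^ 2 + (y i - y j) ^ 2)
    (contact : ∀ i j, ω i j ≠ 0 → i ≠ j ∧ (x i - x j) ^ 2 + (y i - y j) ^ 2 = (r i + r j) ^ 2)
    (symm : ∀ i j, ω i j = ω j i)
    (sum_x : ∀ i, ∑ j, ω (Sum.inl i) j * (x j - x (Sum.inl i)) = 0)
    (sum_y : ∀ i, ∑ j, ω (Sum.inl i) j * (y j - y (Sum.inl i)) = 0)
    (sum_r : ∀ i, ∑ j, ω (Sum.inl i) j * (r (Sum.inl i) + r j) = 0) (i : V) (j : V ⊕ Fin 3) :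
    ω (Sum.inl i) j = 0 := by
  let gx := (∑ k, x (Sum.inr k)) / 3
  let gy := (∑ k, y (Sum.inr k)) / 3
  let β : Fin 3 → V ⊕ Fin 3 → ℝ := fun k =>
    ((x (Sum.inr k) - gx) / 2) • x + ((y (Sum.inr k) - gy) / 2) • y +
      fun _ => 1 / 3 - gx * (x (Sum.inr k) - gx) / 2 - gy * (y (Sum.inr k) - gy) / 2
  have hx : ∀ i, weightedLaplacian ω x (Sum.inl i) = 0 := sum_x
  have hy : ∀ i, weightedLaplacian ω y (Sum.inl i) = 0 := sum_y
  have hβ : ∀ k i, weightedLaplacian ω (β k) (Sum.inl i) = 0 := fun k i => by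
    simp [β, map_add, weightedLaplacian_const, hx, hy]
  have hβ' : ∀ k l, β k (Sum.inr l) = if k = l then 1 else 0 := by
    have h01 := hside 0 1 (by decide)
    have h02 := hside 0 2 (by decide)
    have h12 := hside 1 2 (by decide)
    intro k l
    fin_cases k <;> fin_cases l <;> simp [β, gx, gy, Fin.sum_univ_three] <;> linarith
  have hz : ∀ ω' : V ⊕ Fin 3 → V ⊕ Fin 3 → ℝ, (∀ i j, ω' i j ≠ 0 →
      (x i - x j) ^ 2 + (y i - y j) ^ 2 = (r i + r j) ^ 2) → ∀ i,
      weightedLaplacian ω' (fun i => x i ^ 2 + y i ^ 2 - r i ^ 2) i =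
        2 * r i * (∑ j, ω' i j * (r i + r j)) + 2 * x i * weightedLaplacian ω' x i +
          2 * y i * weightedLaplacian ω' y i := by
    intro ω' h i
    simp only [weightedLaplacian_apply, Finset.mul_sum, ← Finset.sum_add_distrib]
    refine Finset.sum_congr rfl fun j _ => ?_
    by_cases h0 : ω' i j = 0
    · simp [h0]
    · linear_combination ω' i j * h i j h0
  obtain ⟨ω', h1, h2, h3, h4⟩ := exists_weights_extension symm β hβ hβ'
  have contact' : ∀ i j, ω' i j ≠ 0 →
      i ≠ j ∧ (x i - x j) ^ 2 + (y i - y j) ^ 2 = (r i + r j) ^ 2 := by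
    intro i j hij
    rcases i with i | k
    · rw [h2] at hij
      exact contact _ _ hij
    · rcases j with j | l
      · rw [h1, h2, symm] at hij
        exact contact _ _ hij
      · have hkl : k ≠ l := by
          rintro rfl
          rw [h3] at hij
          exact (contact _ _ hij).1 rfl
        refine ⟨by simpa using hkl, ?_⟩
        rw [hside k l hkl, hr, hr]
        norm_num
  rw [← h2]
  refine stress_eq_zero_of_balanced x y r ω' pos separated contact' h1 (h4 x hx) (h4 y hy)
    (fun i => ?_) _ _
  have h5 := hz ω' (fun i j h => (contact' i j h).2) i
  rw [h4 x hx, h4 y hy, h4 _ fun i => by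
    rw [hz ω (fun i j h => (contact i j h).2), hx, hy, sum_r]; ring] at h5
  have h6 : 2 * r i ≠ 0 := by have := pos i; positivity
  simpa [h6, (pos i).ne'] using h5

theorem norm_sub_sq_eq (P Q : Pt) : ‖P - Q‖ ^ 2 = (P 0 - Q 0) ^ 2 + (P 1 - Q 1) ^ 2 := by
  simp [EuclideanSpace.real_norm_sq_eq, Fin.sum_univ_two]

/-- An equilibrium stress of a packing in the tricusp which also balances the variation of the
radii vanishes. -/
theorem tricusp_stress_eq_zero_of_balanced {n : ℕ} {c : Fin 3 → Pt} {p : Fin n → Pt}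
    {r : Fin n → ℝ} (hside : ∀ k l, k ≠ l → ‖c k - c l‖ = 2) (hpack : TricuspPacking c p r)
    {ω : Fin n → Fin n → ℝ} {τ : Fin n → Fin 3 → ℝ} (symm : ∀ i j, ω i j = ω j i)
    (hω : ∀ i j, ¬(i ≠ j ∧ ‖p i - p j‖ = r i + r j) → ω i j = 0)
    (hτ : ∀ i k, ‖p i - c k‖ ≠ 1 + r i → τ i k = 0)
    (equilibrium : ∀ i, (∑ j, ω i j • (p i - p j)) + ∑ k, τ i k • (p i - c k) = 0)
    (balanced : ∀ i, (∑ j, ω i j * (r i + r j)) + ∑ k, τ i k * (1 + r i) = 0) :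
    ω = 0 ∧ τ = 0 := by
  obtain ⟨pos, sep, sepc, -⟩ := hpack
  have hω' : ∀ i j, ω i j ≠ 0 → i ≠ j ∧ ‖p i - p j‖ = r i + r j := fun i j h => by
    by_contra h'
    exact h (hω i j h')
  have hτ' : ∀ i k, τ i k ≠ 0 → ‖p i - c k‖ = 1 + r i := fun i k h => by
    by_contra h'
    exact h (hτ i k h')
  have coord : ∀ (i : Fin n) (a : Fin 2),
      ∑ j, ω i j * (p j a - p i a) + ∑ k, τ i k * (c k a - p i a) = 0 := fun i a => by
    have h := congr_arg (fun z : Pt => z a) (equilibrium i)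
    simp only [PiLp.add_apply, WithLp.ofLp_sum, Finset.sum_apply, PiLp.smul_apply, smul_eq_mul,
      PiLp.sub_apply, PiLp.zero_apply] at h
    rw [← neg_eq_zero, neg_add, ← Finset.sum_neg_distrib, ← Finset.sum_neg_distrib, ← h]
    congr 1 <;> exact Finset.sum_congr rfl fun _ _ => by ring
  have key := stress_eq_zero_of_balanced_of_boundary
    (Sum.elim (fun i => p i 0) fun k => c k 0) (Sum.elim (fun i => p i 1) fun k => c k 1)
    (Sum.elim r fun _ => 1)
    (Sum.elim (fun i => Sum.elim (ω i) (τ i)) fun k => Sum.elim (fun i => τ i k) fun _ => 0)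
    (by rintro (i | k) <;> simp [pos]) (fun _ => rfl)
    (fun k l h => by
      have := norm_sub_sq_eq (c k) (c l)
      rw [hside k l h] at this
      simp only [Sum.elim_inr]
      linarith)
    (by
      rintro (i | k) (j | l) h
      · simp only [Sum.elim_inl, ← norm_sub_sq_eq]
        have := sep i j (by simpa using h)
        have := pos i
        have := pos j
        gcongr
      · simp only [Sum.elim_inl, Sum.elim_inr, ← norm_sub_sq_eq]
        have := sepc i l
        have := pos i
        rw [add_comm]
        gcongr
      · simp only [Sum.elim_inl, Sum.elim_inr, ← norm_sub_sq_eq]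
        have := sepc j k
        have := pos j
        rw [norm_sub_rev]
        gcongr
      · simp only [Sum.elim_inr, ← norm_sub_sq_eq]
        rw [hside k l (by simpa using h)]
        norm_num)
    (by
      rintro (i | k) (j | l) h
      · obtain ⟨h1, h2⟩ := hω' i j h
        exact ⟨by simpa using h1, by simp only [Sum.elim_inl, ← norm_sub_sq_eq, h2]⟩
      · have := hτ' i l h
        exact ⟨by simp, by simp only [Sum.elim_inl, Sum.elim_inr, ← norm_sub_sq_eq, this, add_comm]⟩
      · have := hτ' j k h
        refine ⟨by simp, ?_⟩
        simp only [Sum.elim_inl, Sum.elim_inr, ← norm_sub_sq_eq]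
        rw [norm_sub_rev, this]
      · exact absurd rfl h)
    (by rintro (i | k) (j | l) <;> first | exact symm _ _ | rfl)
    (fun i => by simpa [Fintype.sum_sum_type, Fin.sum_univ_three] using coord i 0)
    (fun i => by simpa [Fintype.sum_sum_type, Fin.sum_univ_three] using coord i 1)
    (fun i => by simpa [Fintype.sum_sum_type, add_comm (r i) 1] using balanced i)
  exact ⟨funext₂ fun i j => key i (Sum.inl j), funext₂ fun i k => key i (Sum.inr k)⟩

section Triangle

variable {c : Fin 3 → Pt}

theorem inner_sum_smul_of_equilateral (hside : ∀ k l, k ≠ l → ‖c k - c l‖ = 2) {d e : Fin 3 → ℝ}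
    (hd : ∑ k, d k = 0) (he : ∑ k, e k = 0) :
    ⟪∑ k, d k • c k, ∑ k, e k • c k⟫ = 2 * ∑ k, d k * e k := by
  have key : ∀ d : Fin 3 → ℝ, ∑ k, d k = 0 →
      ∑ k, d k • c k = d 0 • (c 0 - c 2) + d 1 • (c 1 - c 2) := fun d hd => by
    have : d 2 = -d 0 - d 1 := by
      rw [Fin.sum_univ_three] at hd
      linarith
    rw [Fin.sum_univ_three, this]
    module
  have h02 : ⟪c 0 - c 2, c 0 - c 2⟫ = 4 := by
    rw [real_inner_self_eq_norm_sq, hside 0 2 (by decide)]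
    norm_num
  have h12 : ⟪c 1 - c 2, c 1 - c 2⟫ = 4 := by
    rw [real_inner_self_eq_norm_sq, hside 1 2 (by decide)]
    norm_num
  have h01 : ⟪c 0 - c 2, c 1 - c 2⟫ = 2 := by
    have h := norm_sub_sq_real (c 0 - c 2) (c 1 - c 2)
    rw [sub_sub_sub_cancel_right, hside 0 1 (by decide), hside 0 2 (by decide),
      hside 1 2 (by decide)] at h
    linarith
  rw [key d hd, key e he]
  simp only [inner_add_left, inner_add_right, inner_smul_left, inner_smul_right, h02, h12, h01,
    real_inner_comm (c 0 - c 2) (c 1 - c 2), conj_trivial]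
  rw [Fin.sum_univ_three] at hd he ⊢
  rw [show d 2 = -d 0 - d 1 by linarith, show e 2 = -e 0 - e 1 by linarith]
  ring

/-- The vertices of an equilateral triangle of side `2` as an affine basis of the plane. -/
def equilateralBasis (hside : ∀ k l, k ≠ l → ‖c k - c l‖ = 2) : AffineBasis (Fin 3) ℝ Pt :=
  have h : AffineIndependent ℝ c := by
    rw [affineIndependent_iff_of_fintype]
    intro w hw hw' k
    rw [Finset.univ.weightedVSub_eq_linear_combination hw] at hw'
    have h := inner_sum_smul_of_equilateral hside hw hw
    rw [hw', inner_zero_left, eq_comm, mul_eq_zero_iff_left two_ne_zero,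
      Finset.sum_eq_zero_iff_of_nonneg fun _ _ => mul_self_nonneg _] at h
    simpa using h k (Finset.mem_univ k)
  ⟨c, h, by
    rw [h.affineSpan_eq_top_iff_card_eq_finrank_add_one]
    simp⟩

variable (hside : ∀ k l, k ≠ l → ‖c k - c l‖ = 2)

@[simp]
theorem coe_equilateralBasis : ⇑(equilateralBasis hside) = c := rfl

theorem sum_coord_smul_equilateralBasis (P : Pt) :
    ∑ k, (equilateralBasis hside).coord k P • c k = P :=
  (equilateralBasis hside).linear_combination_coord_eq_self P

theorem equilateralBasis_coord_apply (k l : Fin 3) :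
    (equilateralBasis hside).coord k (c l) = if k = l then 1 else 0 :=
  (equilateralBasis hside).coord_apply k l

theorem inner_sub_eq_of_equilateral (P Q : Pt) {e : Fin 3 → ℝ} (he : ∑ k, e k = 0) :
    ⟪P - Q, ∑ k, e k • c k⟫ = 2 * ∑ k, ((equilateralBasis hside).coord k P -
      (equilateralBasis hside).coord k Q) * e k := by
  rw [← inner_sum_smul_of_equilateral hside (by simp) he]
  simp only [sub_smul, Finset.sum_sub_distrib, sum_coord_smul_equilateralBasis]

theorem norm_sub_sq_eq_of_equilateral (P Q : Pt) :
    ‖P - Q‖ ^ 2 = 2 * ∑ k, ((equilateralBasis hside).coord k P -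
      (equilateralBasis hside).coord k Q) ^ 2 := by
  rw [← real_inner_self_eq_norm_sq]
  have h := inner_sum_smul_of_equilateral hside
    (d := fun k => (equilateralBasis hside).coord k P - (equilateralBasis hside).coord k Q)
    (e := fun k => (equilateralBasis hside).coord k P - (equilateralBasis hside).coord k Q)
    (by simp) (by simp)
  simp only [sub_smul, Finset.sum_sub_distrib, sum_coord_smul_equilateralBasis, ← sq] at h
  exact h

include hside in
/-- A disk in the tricusp does not meet the sides of the triangle. -/
theorem closedBall_subset_interior_convexHull {q : Pt} {s : ℝ} (hs : 0 < s)
    (hq : ∀ k, 1 + s ≤ ‖q - c k‖) (hball : Metric.closedBall q s ⊆ convexHull ℝ (Set.range c)) :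
    Metric.closedBall q s ⊆ interior (convexHull ℝ (Set.range c)) := by
  intro y hy
  have hyc := hball hy
  have hc : Set.range c = Set.range (equilateralBasis hside) := rfl
  rw [hc, AffineBasis.convexHull_eq_nonneg_coord] at hyc
  rw [hc, AffineBasis.interior_convexHull]
  generalize hb : equilateralBasis hside = b at hyc ⊢
  intro k
  refine lt_of_le_of_ne (hyc k) fun hk => ?_
  have hfar : ∀ l, 1 ≤ ‖y - c l‖ := fun l => by
    have h1 := norm_sub_le_norm_sub_add_norm_sub q y (c l)
    have h2 : ‖q - y‖ ≤ s := by
      rw [← dist_eq_norm, dist_comm]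
      exact hy
    linarith [hq l]
  have hfar' : ∀ l, 1 ≤ ‖y - c l‖ ^ 2 := fun l => one_le_pow₀ (hfar l)
  have hq' : ∀ l, (1 + s) ^ 2 ≤ ‖q - c l‖ ^ 2 := fun l => by
    have := hq l
    gcongr
  have hy' : ‖q - y‖ ^ 2 ≤ s ^ 2 := by
    have h2 : ‖q - y‖ ≤ s := by
      rw [← dist_eq_norm, dist_comm]
      exact hy
    gcongr
  have hsum : b.coord 0 y + b.coord 1 y + b.coord 2 y = 1 := by
    rw [← Fin.sum_univ_three fun k => b.coord k y]
    exact b.sum_coord_apply_eq_one y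
  have hsum' : b.coord 0 q + b.coord 1 q + b.coord 2 q = 1 := by
    rw [← Fin.sum_univ_three fun k => b.coord k q]
    exact b.sum_coord_apply_eq_one q
  simp only [norm_sub_sq_eq_of_equilateral hside, equilateralBasis_coord_apply] at hfar' hq' hy'
  simp only [hb,
    Fin.sum_univ_three] at hfar' hq' hy'
  have f0 := hfar' 0
  have f1 := hfar' 1
  have f2 := hfar' 2
  have q0 := hq' 0
  have q1 := hq' 1
  have q2 := hq' 2
  have c0 := hyc 0
  have c1 := hyc 1
  have c2 := hyc 2
  simp only [Fin.isValue, one_ne_zero, zero_ne_one, Fin.reduceEq, if_true, if_false]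
    at f0 f1 f2 q0 q1 q2
  have aux : ∀ x₀ x₁ x₂ u₀ u₁ u₂ : ℝ, x₀ = 0 → 0 ≤ x₁ → 0 ≤ x₂ → x₀ + x₁ + x₂ = 1 →
      u₀ + u₁ + u₂ = 1 → 1 ≤ 2 * (x₀ ^ 2 + (x₁ - 1) ^ 2 + x₂ ^ 2) →
      1 ≤ 2 * (x₀ ^ 2 + x₁ ^ 2 + (x₂ - 1) ^ 2) →
      (1 + s) ^ 2 ≤ 2 * (u₀ ^ 2 + (u₁ - 1) ^ 2 + u₂ ^ 2) →
      (1 + s) ^ 2 ≤ 2 * (u₀ ^ 2 + u₁ ^ 2 + (u₂ - 1) ^ 2) →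
      2 * ((u₀ - x₀) ^ 2 + (u₁ - x₁) ^ 2 + (u₂ - x₂) ^ 2) ≤ s ^ 2 → False := by
    intro x₀ x₁ x₂ u₀ u₁ u₂ h0 h1 h2 hx hu f1 f2 g1 g2 g
    obtain rfl : x₁ = 1 - x₂ := by linarith
    subst h0
    have e1 : 1 / 2 ≤ x₂ := le_of_sq_le_sq (by linarith only [f1]) h2
    have e2 : 1 / 2 ≤ 1 - x₂ := le_of_sq_le_sq (by linarith only [f2]) h1
    obtain rfl : x₂ = 1 / 2 := by linarith only [e1, e2]
    obtain rfl : u₀ = 1 - u₁ - u₂ := by linarith only [hu]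
    linarith only [g1, g2, g, hs]
  fin_cases k
  · exact aux (b.coord 0 y) (b.coord 1 y) (b.coord 2 y) (b.coord 0 q) (b.coord 1 q) (b.coord 2 q)
      hk.symm c1 c2 hsum hsum' (by linarith) (by linarith) (by linarith) (by linarith) hy'
  · exact aux (b.coord 1 y) (b.coord 0 y) (b.coord 2 y) (b.coord 1 q) (b.coord 0 q) (b.coord 2 q)
      hk.symm c0 c2 (by linarith) (by linarith) (by linarith) (by linarith) (by linarith)
      (by linarith) (by linarith)
  · exact aux (b.coord 2 y) (b.coord 0 y) (b.coord 1 y) (b.coord 2 q) (b.coord 0 q) (b.coord 1 q)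
      hk.symm c0 c1 (by linarith) (by linarith) (by linarith) (by linarith) (by linarith)
      (by linarith) (by linarith)

end Triangle

open Filter Topology in
theorem eventually_norm_le_norm_add_smul {a v : Pt} {s : ℝ} (hs : s ≤ ‖a‖)
    (h : ‖a‖ = s → 0 ≤ ⟪a, v⟫) : ∀ᶠ t in 𝓝[≥] (0 : ℝ), s ≤ ‖a + t • v‖ := by
  rcases hs.eq_or_lt with rfl | hs
  · filter_upwards [self_mem_nhdsWithin] with t ht
    refine le_of_sq_le_sq ?_ (norm_nonneg _)
    rw [norm_add_sq_real, inner_smul_right]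
    have := mul_nonneg (Set.mem_Ici.1 ht) (h rfl)
    nlinarith [sq_nonneg ‖t • v‖]
  · have : ContinuousAt (fun t : ℝ => ‖a + t • v‖) 0 := by fun_prop
    refine nhdsWithin_le_nhds ((this.eventually_const_lt (u := s) (by simpa)).mono fun _ h => h.le)

open Filter Topology in
theorem eventually_closedBall_add_smul_subset {U : Set Pt} (hU : IsOpen U) {q v : Pt} {s : ℝ}
    (h : Metric.closedBall q s ⊆ U) : ∀ᶠ t in 𝓝 (0 : ℝ), Metric.closedBall (q + t • v) s ⊆ U := by
  obtain ⟨δ, hδ, hδU⟩ := (isCompact_closedBall q s).exists_cthickening_subset_open hU h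
  have : ContinuousAt (fun t : ℝ => ‖t • v‖) 0 := by fun_prop
  filter_upwards [this.eventually_lt_const (u := δ) (by simpa)] with t ht y hy
  refine hδU (Metric.mem_cthickening_of_dist_le y (y - t • v) δ _ ?_ ?_)
  · rw [mem_closedBall_iff_norm] at hy ⊢
    rwa [sub_right_comm, sub_sub, ] 
  · rw [dist_eq_norm, sub_sub_cancel]
    exact ht.le

open Filter Topology in
/-- A jammed packing in the tricusp is infinitesimally rigid. -/
theorem eq_zero_of_tricuspJammed {ι : Type} [Finite ι] {c : Fin 3 → Pt} {p v : ι → Pt}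
    {r : ι → ℝ} (hside : ∀ k l, k ≠ l → ‖c k - c l‖ = 2) (hpack : TricuspPacking c p r)
    (hjam : TricuspJammed c p r)
    (hdisk : ∀ i j, i ≠ j → ‖p i - p j‖ = r i + r j → 0 ≤ ⟪p i - p j, v i - v j⟫)
    (hboundary : ∀ i k, ‖p i - c k‖ = 1 + r i → 0 ≤ ⟪p i - c k, v i⟫) : v = 0 := by
  obtain ⟨pos, sep, sepc, ball⟩ := hpack
  have hev : ∀ᶠ t in 𝓝[≥] (0 : ℝ), TricuspPacking c (fun i => p i + t • v i) r := by
    have h1 : ∀ᶠ t in 𝓝[≥] (0 : ℝ), ∀ i j, i ≠ j →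
        r i + r j ≤ ‖p i + t • v i - (p j + t • v j)‖ := by
      simp only [eventually_all]
      intro i j hij
      filter_upwards [eventually_norm_le_norm_add_smul (sep i j hij) (hdisk i j hij)] with t ht
      rwa [add_sub_add_comm, ← smul_sub]
    have h2 : ∀ᶠ t in 𝓝[≥] (0 : ℝ), ∀ i k, 1 + r i ≤ ‖p i + t • v i - c k‖ := by
      simp only [eventually_all]
      intro i k
      filter_upwards [eventually_norm_le_norm_add_smul (sepc i k) (hboundary i k)] with t ht
      rwa [add_sub_right_comm]
    have h3 : ∀ᶠ t in 𝓝[≥] (0 : ℝ), ∀ i, Metric.closedBall (p i + t • v i) (r i) ⊆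
        interior (convexHull ℝ (Set.range c)) := by
      rw [eventually_all]
      exact fun i => nhdsWithin_le_nhds (eventually_closedBall_add_smul_subset isOpen_interior
        (closedBall_subset_interior_convexHull hside (pos i) (sepc i) fun y hy => (ball i hy).1))
    filter_upwards [h1, h2, h3] with t h1 h2 h3
    refine ⟨pos, h1, h2, fun i y hy => ⟨interior_subset (h3 i hy), fun k => ?_⟩⟩
    have := norm_sub_le_norm_sub_add_norm_sub (p i + t • v i) y (c k)
    rw [mem_closedBall_iff_norm, norm_sub_rev] at hy
    linarith [h2 i k]
  obtain ⟨ε, hε, hsub⟩ := mem_nhdsGE_iff_exists_Icc_subset.1 hev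
  have hε : 0 < ε := hε
  have hq := hjam (fun t i => p i + (t * ε) • v i) (fun i => by fun_prop) (by simp)
    (fun t ht => hsub ⟨by have := ht.1; positivity, by nlinarith [ht.2]⟩) 1 (by simp)
  funext i
  simpa [hε.ne'] using congr_fun hq i

theorem sum_prod_eq_sum_lt {α M : Type*} [Fintype α] [LinearOrder α] [AddCommMonoid M]
    {P : α × α → Prop} (hP : ∀ x, P x → P x.swap) [Fintype {x : α × α // x.1 < x.2 ∧ P x}]
    (f : α × α → M) (hf : ∀ x, ¬(x.1 ≠ x.2 ∧ P x) → f x = 0) :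
    ∑ x, f x = ∑ x : {x : α × α // x.1 < x.2 ∧ P x}, (f x + f x.1.swap) := by
  classical
  have h1 : ∀ x, f x = (if x.1 < x.2 ∧ P x then f x else 0) +
      if x.2 < x.1 ∧ P x then f x else 0 := fun x => by
    by_cases hx : x.1 ≠ x.2 ∧ P x
    · rcases lt_or_gt_of_ne hx.1 with h | h <;> simp [h, h.not_gt, hx.2]
    · rw [hf x hx]
      simp
  rw [Finset.sum_congr rfl fun x _ => h1 x, Finset.sum_add_distrib,
    ← (Equiv.prodComm α α).sum_comp fun x => if x.2 < x.1 ∧ P x then f x else 0,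
    ← Finset.sum_add_distrib,
    ← Finset.sum_subtype (Finset.univ.filter fun x : α × α => x.1 < x.2 ∧ P x) (by simp)
      fun x => f x + f x.swap, Finset.sum_filter]
  refine Finset.sum_congr rfl fun x _ => ?_
  have h2 : P x.swap ↔ P x := ⟨hP x.swap, hP x⟩
  simp only [Equiv.prodComm_apply, Prod.fst_swap, Prod.snd_swap, h2]
  split_ifs <;> simp

section Rigidity

variable {n : ℕ}

/-- The disk–disk contacts of a packing, as increasing pairs of indices. -/
abbrev DiskContact (p : Fin n → Pt) (r : Fin n → ℝ) : Type :=
  {x : Fin n × Fin n // x.1 < x.2 ∧ ‖p x.1 - p x.2‖ = r x.1 + r x.2}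

/-- The disk–boundary contacts of a packing in the tricusp. -/
abbrev BoundaryContact (c : Fin 3 → Pt) (p : Fin n → Pt) (r : Fin n → ℝ) : Type :=
  {x : Fin n × Fin 3 // ‖p x.1 - c x.2‖ = 1 + r x.1}

/-- The contacts of a packing in the tricusp. -/
abbrev TricuspContact (c : Fin 3 → Pt) (p : Fin n → Pt) (r : Fin n → ℝ) : Type :=
  DiskContact p r ⊕ BoundaryContact c p r

open Classical in
instance (p : Fin n → Pt) (r : Fin n → ℝ) : Fintype (DiskContact p r) :=
  Subtype.fintype _

open Classical in
instance (c : Fin 3 → Pt) (p : Fin n → Pt) (r : Fin n → ℝ) : Fintype (BoundaryContact c p r) :=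
  Subtype.fintype _

variable (c : Fin 3 → Pt) (p : Fin n → Pt) (r : Fin n → ℝ)

/-- Half of the derivative of the squared distances along the contacts with respect to the
centers. -/
def lengthVariation : (Fin n → Pt) →ₗ[ℝ] (TricuspContact c p r → ℝ) where
  toFun v := Sum.elim (fun x => ⟪p x.1.1 - p x.1.2, v x.1.1 - v x.1.2⟫)
    fun x => ⟪p x.1.1 - c x.1.2, v x.1.1⟫
  map_add' v w := by
    ext (x | x)
    · simp [add_sub_add_comm, inner_add_right]
    · simp [inner_add_right]
  map_smul' a v := by
    ext (x | x)
    · simp [← smul_sub, inner_smul_right]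
    · simp [inner_smul_right]

/-- Half of the derivative of the squared sums of radii along the contacts with respect to the
radii. -/
def radiusVariation : (Fin n → ℝ) →ₗ[ℝ] (TricuspContact c p r → ℝ) where
  toFun s := Sum.elim (fun x => (r x.1.1 + r x.1.2) * (s x.1.1 + s x.1.2))
    fun x => (1 + r x.1.1) * s x.1.1
  map_add' s t := by
    ext (x | x) <;> simp <;> ring
  map_smul' a s := by
    ext (x | x) <;> simp <;> ring

open Classical in
/-- The stress with the given values on the contacts. -/
def stressOfContacts : (TricuspContact c p r → ℝ) →ₗ[ℝ]
    ((Fin n → Fin n → ℝ) × (Fin n → Fin 3 → ℝ)) where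
  toFun w := (fun i j => if h : i < j ∧ ‖p i - p j‖ = r i + r j then w (Sum.inl ⟨(i, j), h⟩) else
      if h : j < i ∧ ‖p j - p i‖ = r j + r i then w (Sum.inl ⟨(j, i), h⟩) else 0,
    fun i k => if h : ‖p i - c k‖ = 1 + r i then w (Sum.inr ⟨(i, k), h⟩) else 0)
  map_add' w w' := by
    ext i j
    · simp only [Prod.fst_add, Pi.add_apply]
      split_ifs <;> simp
    · simp only [Prod.snd_add, Pi.add_apply]
      split_ifs <;> simp
  map_smul' a w := by
    ext i j
    · simp only [Prod.smul_fst, Pi.smul_apply]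
      split_ifs <;> simp
    · simp only [Prod.smul_snd, Pi.smul_apply]
      split_ifs <;> simp

variable {c p r}

theorem stressOfContacts_fst_apply (w : TricuspContact c p r → ℝ) (x : DiskContact p r) :
    (stressOfContacts c p r w).1 x.1.1 x.1.2 = w (Sum.inl x) :=
  dif_pos x.2

theorem stressOfContacts_snd_apply (w : TricuspContact c p r → ℝ) (x : BoundaryContact c p r) :
    (stressOfContacts c p r w).2 x.1.1 x.1.2 = w (Sum.inr x) :=
  dif_pos x.2

theorem stressOfContacts_fst_symm (w : TricuspContact c p r → ℝ) (i j : Fin n) :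
    (stressOfContacts c p r w).1 i j = (stressOfContacts c p r w).1 j i := by
  simp only [stressOfContacts, LinearMap.coe_mk, AddHom.coe_mk]
  split_ifs with h1 h2
  · exact absurd h1.1 h2.1.not_gt
  all_goals rfl

theorem stressOfContacts_fst_eq_zero (w : TricuspContact c p r → ℝ) {i j : Fin n}
    (h : ¬(i ≠ j ∧ ‖p i - p j‖ = r i + r j)) : (stressOfContacts c p r w).1 i j = 0 := by
  simp only [stressOfContacts, LinearMap.coe_mk, AddHom.coe_mk]
  rw [dif_neg fun h' => h ⟨h'.1.ne, h'.2⟩,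
    dif_neg fun h' => h ⟨h'.1.ne', by rw [norm_sub_rev, h'.2, add_comm]⟩]

theorem stressOfContacts_snd_eq_zero (w : TricuspContact c p r → ℝ) {i : Fin n} {k : Fin 3}
    (h : ‖p i - c k‖ ≠ 1 + r i) : (stressOfContacts c p r w).2 i k = 0 :=
  dif_neg h

theorem stressOfContacts_injective : Function.Injective (stressOfContacts c p r) := by
  intro w w' h
  ext (x | x)
  · rw [← stressOfContacts_fst_apply w, h, stressOfContacts_fst_apply]
  · rw [← stressOfContacts_snd_apply w, h, stressOfContacts_snd_apply]

/-- A stress is determined by its values on the contacts. -/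
theorem exists_stressOfContacts_eq {ω : (Fin n → Fin n → ℝ) × (Fin n → Fin 3 → ℝ)}
    (hω : ω ∈ tricuspStressSpace c p r) : ∃ w, stressOfContacts c p r w = ω := by
  obtain ⟨h1, h2, h3, -⟩ := hω
  refine ⟨Sum.elim (fun x => ω.1 x.1.1 x.1.2) fun x => ω.2 x.1.1 x.1.2, ?_⟩
  ext i j
  · simp only [stressOfContacts, LinearMap.coe_mk, AddHom.coe_mk, Sum.elim_inl]
    split_ifs with h h'
    · rfl
    · exact h2 j i
    · refine (h1 i j fun hij => ?_).symm
      rcases lt_or_gt_of_ne hij.1 with hlt | hlt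
      · exact h ⟨hlt, hij.2⟩
      · exact h' ⟨hlt, by rw [norm_sub_rev, hij.2, add_comm]⟩
  · simp only [stressOfContacts, LinearMap.coe_mk, AddHom.coe_mk, Sum.elim_inr]
    split_ifs with h
    · rfl
    · exact (h3 i j h).symm

theorem sum_stressOfContacts_mul (w : TricuspContact c p r → ℝ) (f : Fin n → Fin n → ℝ)
    (g : Fin n → Fin 3 → ℝ) :
    ∑ i, (∑ j, (stressOfContacts c p r w).1 i j * f i j +
      ∑ k, (stressOfContacts c p r w).2 i k * g i k) =
    w ⬝ᵥ Sum.elim (fun x => f x.1.1 x.1.2 + f x.1.2 x.1.1) fun x => g x.1.1 x.1.2 := by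
  classical
  rw [Finset.sum_add_distrib, ← Fintype.sum_prod_type', ← Fintype.sum_prod_type',
    dotProduct, Fintype.sum_sum_type]
  congr 1
  · rw [sum_prod_eq_sum_lt (P := fun x => ‖p x.1 - p x.2‖ = r x.1 + r x.2)
      (fun x hx => by rw [Prod.fst_swap, Prod.snd_swap, norm_sub_rev, hx, add_comm]) _
      fun x hx => by rw [stressOfContacts_fst_eq_zero w hx, zero_mul]]
    refine Finset.sum_congr rfl fun x _ => ?_
    rw [Prod.fst_swap, Prod.snd_swap, stressOfContacts_fst_symm w x.1.2,
      stressOfContacts_fst_apply, ← mul_add, Sum.elim_inl]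
  · have h : ∀ x : Fin n × Fin 3, (stressOfContacts c p r w).2 x.1 x.2 * g x.1 x.2 =
        if ‖p x.1 - c x.2‖ = 1 + r x.1 then (stressOfContacts c p r w).2 x.1 x.2 * g x.1 x.2
          else 0 := fun x => by
      split_ifs with h
      · rfl
      · rw [stressOfContacts_snd_eq_zero w h, zero_mul]
    rw [Finset.sum_congr rfl fun x _ => h x, ← Finset.sum_filter,
      Finset.sum_subtype (p := fun x : Fin n × Fin 3 => ‖p x.1 - c x.2‖ = 1 + r x.1) _ (by simp)]
    exact Finset.sum_congr rfl fun x _ => by rw [stressOfContacts_snd_apply, Sum.elim_inr]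

theorem dotProduct_lengthVariation (w : TricuspContact c p r → ℝ) (v : Fin n → Pt) :
    w ⬝ᵥ lengthVariation c p r v = ∑ i, ⟪(∑ j, (stressOfContacts c p r w).1 i j • (p i - p j)) +
      ∑ k, (stressOfContacts c p r w).2 i k • (p i - c k), v i⟫ := by
  simp only [inner_add_left, sum_inner, inner_smul_left, conj_trivial]
  rw [sum_stressOfContacts_mul w (fun i j => ⟪p i - p j, v i⟫) fun i k => ⟪p i - c k, v i⟫]
  congr 1
  ext (x | x)
  · simp [lengthVariation, inner_sub_left, inner_sub_right]
    ring
  · rfl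

theorem dotProduct_radiusVariation (w : TricuspContact c p r → ℝ) (s : Fin n → ℝ) :
    w ⬝ᵥ radiusVariation c p r s =
      ∑ i, ((∑ j, (stressOfContacts c p r w).1 i j * (r i + r j)) +
        ∑ k, (stressOfContacts c p r w).2 i k * (1 + r i)) * s i := by
  simp only [add_mul, Finset.sum_mul, mul_assoc]
  rw [sum_stressOfContacts_mul w (fun i j => r i * s i + r j * s i)
    fun i _ => 1 * s i + r i * s i]
  congr 1
  ext (x | x) <;>
  · simp only [radiusVariation, LinearMap.coe_mk, AddHom.coe_mk, Sum.elim_inl, Sum.elim_inr]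
    ring

/-- A stress is in equilibrium if and only if it annihilates the variations of the lengths. -/
theorem stressOfContacts_mem_iff (w : TricuspContact c p r → ℝ) :
    stressOfContacts c p r w ∈ tricuspStressSpace c p r ↔
      ∀ v, w ⬝ᵥ lengthVariation c p r v = 0 := by
  constructor
  · rintro ⟨-, -, -, h⟩ v
    rw [dotProduct_lengthVariation]
    exact Finset.sum_eq_zero fun i _ => by rw [h i, inner_zero_left]
  · intro h
    refine ⟨fun i j => stressOfContacts_fst_eq_zero w, stressOfContacts_fst_symm w,
      fun i k => stressOfContacts_snd_eq_zero w, fun i => ?_⟩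
    have h' := h (Pi.single i (∑ j, (stressOfContacts c p r w).1 i j • (p i - p j) +
      ∑ k, (stressOfContacts c p r w).2 i k • (p i - c k)))
    rw [dotProduct_lengthVariation, Finset.sum_eq_single i
      (fun j _ hj => by rw [Pi.single_eq_of_ne hj, inner_zero_right]) (by simp)] at h'
    simpa using h'

theorem finrank_tricuspStressSpace (hinj : Function.Injective (lengthVariation c p r)) :
    Module.finrank ℝ (tricuspStressSpace c p r) + 2 * n = Fintype.card (TricuspContact c p r) := by
  classical
  let f := (lengthVariation c p r).dualMap ∘ₗ (dotProductEquiv ℝ (TricuspContact c p r)).toLinearMap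
  have hf : tricuspStressSpace c p r = (LinearMap.ker f).map (stressOfContacts c p r) := by
    ext ω
    rw [Submodule.mem_map]
    constructor
    · intro hω
      obtain ⟨w, rfl⟩ := exists_stressOfContacts_eq hω
      exact ⟨w, LinearMap.ext fun v => (stressOfContacts_mem_iff w).1 hω v, rfl⟩
    · rintro ⟨w, hw, rfl⟩
      exact (stressOfContacts_mem_iff w).2 fun v => LinearMap.congr_fun hw v
  have hr : Module.finrank ℝ (LinearMap.range f) = 2 * n := by
    rw [LinearMap.range_comp_of_range_eq_top _ (LinearEquiv.range _),
      LinearMap.finrank_range_dualMap_eq_finrank_range, LinearMap.finrank_range_of_inj hinj]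
    rw [Module.finrank_pi_fintype]
    simp [mul_comm]
  rw [hf, ← ((LinearMap.ker f).equivMapOfInjective _ stressOfContacts_injective).finrank_eq, ← hr,
    add_comm, f.finrank_range_add_finrank_ker, Module.finrank_fintype_fun_eq_card]

/-- The variations of lengths and radii are jointly surjective on the contacts. -/
theorem surjective_lengthVariation_coprod (hside : ∀ k l, k ≠ l → ‖c k - c l‖ = 2)
    (hpack : TricuspPacking c p r) :
    Function.Surjective ((lengthVariation c p r).coprod (-radiusVariation c p r)) := by
  classical
  rw [← LinearMap.dualMap_injective_iff, injective_iff_map_eq_zero]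
  intro φ hφ
  obtain ⟨w, rfl⟩ := (dotProductEquiv ℝ (TricuspContact c p r)).surjective φ
  have h1 : ∀ v, w ⬝ᵥ lengthVariation c p r v = 0 := fun v => by
    have := LinearMap.congr_fun hφ (v, 0)
    simpa using this
  have h2 : ∀ s, w ⬝ᵥ radiusVariation c p r s = 0 := fun s => by
    have := LinearMap.congr_fun hφ (0, s)
    simpa using this
  obtain ⟨h3, h4, h5, h6⟩ := (stressOfContacts_mem_iff w).2 h1
  have h7 := tricusp_stress_eq_zero_of_balanced hside hpack h4 h3 h5 h6 fun i => by
    have := h2 (Pi.single i 1)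
    rw [dotProduct_radiusVariation] at this
    simpa [Pi.single_apply] using this
  rw [(stressOfContacts_injective (a₁ := w) (a₂ := 0) (by
    rw [map_zero]
    exact Prod.ext h7.1 h7.2) : w = 0),
    map_zero]

end Rigidity

section Derivation

variable {c : Fin 3 → Pt} (hside : ∀ k l, k ≠ l → ‖c k - c l‖ = 2)

/-- The derivative of a point along a derivation of `ℝ`, taken in barycentric coordinates. -/
def derivPoint : Derivation ℚ ℝ ℝ →ₗ[ℝ] Pt → Pt where
  toFun D P := ∑ k, D ((equilateralBasis hside).coord k P) • c k
  map_add' D E := by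
    ext1 P
    simp [add_smul, Finset.sum_add_distrib]
  map_smul' a D := by
    ext1 P
    simp [mul_smul, Finset.smul_sum]

theorem derivPoint_apply (D : Derivation ℚ ℝ ℝ) (P : Pt) :
    derivPoint hside D P = ∑ k, D ((equilateralBasis hside).coord k P) • c k := rfl

theorem derivPoint_vertex (D : Derivation ℚ ℝ ℝ) (l : Fin 3) : derivPoint hside D (c l) = 0 := by
  simp only [derivPoint_apply, equilateralBasis_coord_apply]
  refine Finset.sum_eq_zero fun k _ => ?_
  split_ifs <;> simp

theorem inner_sub_derivPoint (D : Derivation ℚ ℝ ℝ) (P Q : Pt) :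
    ⟪P - Q, derivPoint hside D P - derivPoint hside D Q⟫ = ‖P - Q‖ * D ‖P - Q‖ := by
  have hD : ∀ P, ∑ k, D ((equilateralBasis hside).coord k P) = 0 := fun P => by
    rw [← map_sum, AffineBasis.sum_coord_apply_eq_one, Derivation.map_one_eq_zero]
  have h := congr_arg D (norm_sub_sq_eq_of_equilateral hside P Q)
  simp only [two_mul, map_add, map_sum, Derivation.leibniz_pow, map_sub, pow_one, smul_eq_mul,
    Nat.add_one_sub_one, nsmul_eq_mul, Nat.cast_ofNat] at h
  rw [derivPoint_apply, derivPoint_apply, ← Finset.sum_sub_distrib]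
  simp only [← sub_smul]
  rw [inner_sub_eq_of_equilateral hside P Q (by rw [Finset.sum_sub_distrib, hD, hD, sub_zero])]
  rw [Finset.sum_add_distrib] at h
  linarith

theorem derivPoint_mem_ker {n : ℕ} (p : Fin n → Pt) (r : Fin n → ℝ) (D : Derivation ℚ ℝ ℝ) :
    (fun i => derivPoint hside D (p i), fun i => D (r i)) ∈
      LinearMap.ker ((lengthVariation c p r).coprod (-radiusVariation c p r)) := by
  rw [LinearMap.mem_ker, LinearMap.coprod_apply, LinearMap.neg_apply, ← sub_eq_add_neg, sub_eq_zero]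
  ext (x | x)
  · change ⟪p x.1.1 - p x.1.2, derivPoint hside D (p x.1.1) - derivPoint hside D (p x.1.2)⟫ =
      (r x.1.1 + r x.1.2) * (D (r x.1.1) + D (r x.1.2))
    rw [inner_sub_derivPoint, x.2.2, map_add]
  · change ⟪p x.1.1 - c x.1.2, derivPoint hside D (p x.1.1)⟫ = (1 + r x.1.1) * D (r x.1.1)
    have := inner_sub_derivPoint hside D (p x.1.1) (c x.1.2)
    rwa [derivPoint_vertex, sub_zero, x.2, map_add, Derivation.map_one_eq_zero, zero_add] at this

include hside in
/-- If `m` ratios of the radii are algebraically independent, then the contact equations of the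
packing have at least `m` independent first-order variations. -/
theorem card_le_finrank_ker_of_algebraicIndependent {n : ℕ} (p : Fin n → Pt) (r : Fin n → ℝ)
    {ι : Type*} [Fintype ι] (a b : ι → Fin n)
    (hr : AlgebraicIndependent ℚ fun i => r (a i) / r (b i)) :
    Fintype.card ι ≤ Module.finrank ℝ
      (LinearMap.ker ((lengthVariation c p r).coprod (-radiusVariation c p r))) := by
  classical
  choose D hD using fun i : ι => exists_derivation_of_algebraicIndependent hr (Pi.single i 1)
  let Ψ : Derivation ℚ ℝ ℝ →ₗ[ℝ]
      LinearMap.ker ((lengthVariation c p r).coprod (-radiusVariation c p r)) :=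
    { toFun := fun D => ⟨_, derivPoint_mem_ker hside p r D⟩
      map_add' := fun D E => by
        ext1
        simp only [map_add]
        rfl
      map_smul' := fun a D => by
        ext1
        simp only [map_smul]
        rfl }
  refine LinearIndependent.fintype_card_le_finrank (b := fun i => Ψ (D i)) ?_
  rw [Fintype.linearIndependent_iff]
  intro g hg i
  simp only [← map_smul, ← map_sum] at hg
  have h : ∀ j, (∑ i, g i • D i) (r j) = 0 := fun j =>
    congr_fun (congr_arg (fun x => x.1.2) hg) j
  have h' : (∑ i, g i • D i) (r (a i) / r (b i)) = 0 := by
    rw [Derivation.leibniz_div, h, h]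
    simp
  have hsum : ⇑(∑ i, g i • D i) = ∑ i, ⇑(g i • D i) := map_sum Derivation.coeFnAddMonoidHom _ _
  simpa [hsum, hD, Pi.single_apply] using h'

end Derivation

theorem injective_lengthVariation {n : ℕ} {c : Fin 3 → Pt} {p : Fin n → Pt} {r : Fin n → ℝ}
    (hrigid : ∀ v, 0 ≤ lengthVariation c p r v → v = 0) :
    Function.Injective (lengthVariation c p r) := by
  rw [injective_iff_map_eq_zero]
  exact fun v hv => hrigid v hv.ge

theorem eq_zero_of_lengthVariation_nonneg {n : ℕ} {c : Fin 3 → Pt} {p : Fin n → Pt} {r : Fin n → ℝ}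
    (hside : ∀ k l, k ≠ l → ‖c k - c l‖ = 2) (hpack : TricuspPacking c p r)
    (hjam : TricuspJammed c p r) {v : Fin n → Pt} (hv : 0 ≤ lengthVariation c p r v) : v = 0 := by
  refine eq_zero_of_tricuspJammed hside hpack hjam (fun i j hij h => ?_) fun i k h =>
    hv (Sum.inr ⟨(i, k), h⟩)
  rcases lt_or_gt_of_ne hij with hlt | hlt
  · exact hv (Sum.inl ⟨(i, j), hlt, h⟩)
  · have := hv (Sum.inl ⟨(j, i), hlt, by rw [norm_sub_rev, h, add_comm]⟩)
    rw [← neg_sub (p j), ← neg_sub (v j), inner_neg_neg]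
    exact this

theorem two_mul_lt_card_tricuspContact {n : ℕ} (hn : 0 < n) {c : Fin 3 → Pt} {p : Fin n → Pt}
    {r : Fin n → ℝ} (hrigid : ∀ v, 0 ≤ lengthVariation c p r v → v = 0) :
    2 * n < Fintype.card (TricuspContact c p r) := by
  have hinj := injective_lengthVariation hrigid
  have hdim : Module.finrank ℝ (Fin n → Pt) = 2 * n := by
    rw [Module.finrank_pi_fintype]
    simp [mul_comm]
  have hle := LinearMap.finrank_le_finrank_of_injective hinj
  rw [hdim, Module.finrank_fintype_fun_eq_card] at hle
  refine lt_of_le_of_ne hle fun heq => ?_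
  obtain ⟨v, hv⟩ := (LinearMap.injective_iff_surjective_of_finrank_eq_finrank
    (by rw [hdim, heq, Module.finrank_fintype_fun_eq_card])).1 hinj 1
  have : Nonempty (TricuspContact c p r) := Fintype.card_pos_iff.1 (by omega)
  rw [hrigid v (by rw [hv]; exact zero_le_one), map_zero] at hv
  exact zero_ne_one hv

theorem ncard_diskContact_add {n : ℕ} (c : Fin 3 → Pt) (p : Fin n → Pt) (r : Fin n → ℝ) :
    {x : Fin n × Fin n | x.1 ≠ x.2 ∧ ‖p x.1 - p x.2‖ = r x.1 + r x.2}.ncard +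
      2 * {x : Fin n × Fin 3 | ‖p x.1 - c x.2‖ = 1 + r x.1}.ncard =
    2 * Fintype.card (TricuspContact c p r) := by
  classical
  have h1 : {x : Fin n × Fin n | x.1 ≠ x.2 ∧ ‖p x.1 - p x.2‖ = r x.1 + r x.2}.ncard =
      2 * Fintype.card (DiskContact p r) := by
    have h := sum_prod_eq_sum_lt (P := fun x => ‖p x.1 - p x.2‖ = r x.1 + r x.2)
      (fun x hx => by rw [Prod.fst_swap, Prod.snd_swap, norm_sub_rev, hx, add_comm])
      (fun x => if x.1 ≠ x.2 ∧ ‖p x.1 - p x.2‖ = r x.1 + r x.2 then 1 else 0)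
      fun x hx => if_neg hx
    rw [Finset.sum_boole, Finset.sum_congr rfl (g := fun _ => 2) fun x _ => by
      rw [if_pos ⟨x.2.1.ne, x.2.2⟩, if_pos ⟨x.2.1.ne', by
        rw [Prod.fst_swap, Prod.snd_swap, norm_sub_rev, x.2.2, add_comm]⟩]] at h
    rw [Set.ncard_eq_toFinset_card', Set.toFinset_ofPred]
    simpa [mul_comm] using h
  have h2 : {x : Fin n × Fin 3 | ‖p x.1 - c x.2‖ = 1 + r x.1}.ncard =
      Fintype.card (BoundaryContact c p r) := by
    rw [← Nat.card_coe_set_eq, Nat.card_eq_fintype_card]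
    rfl
  rw [h1, h2, Fintype.card_sum]
  ring

/-- **The tricusp isostatic theorem** (Theorem 9.1).  If a jammed packing of `n` disks
in the tricusp (bounded by three mutually tangent unit circles, centered at the vertices
`cv k` of an equilateral triangle of side `2`) has generic radius ratios
`r₂/r₁, …, rₙ/r₁`, then the total number of contacts is `2n + 1` (disk–disk contacts
are counted here as ordered pairs, hence doubled) and the space of equilibrium stresses
is one-dimensional; that is, the packing is isostatic. -/
theorem tricusp_isostatic_theorem
    (cv : Fin 3 → Pt) (hside : ∀ k l, k ≠ l → ‖cv k - cv l‖ = 2)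
    (n : ℕ) (hn : 0 < n) (p : Fin n → Pt) (r : Fin n → ℝ)
    (hpack : TricuspPacking cv p r)
    (hjam : TricuspJammed cv p r)
    (hgen : AlgebraicIndependent ℚ (fun i : Fin (n - 1) =>
      r ⟨(i : ℕ) + 1, by have := i.isLt; omega⟩ / r ⟨0, hn⟩)) :
    ({x : Fin n × Fin n | x.1 ≠ x.2 ∧ ‖p x.1 - p x.2‖ = r x.1 + r x.2}.ncard
        + 2 * {x : Fin n × Fin 3 | ‖p x.1 - cv x.2‖ = 1 + r x.1}.ncard
      = 2 * (2 * n + 1)) ∧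
    Module.finrank ℝ (tricuspStressSpace cv p r) = 1 := by
  have hrigid : ∀ v, 0 ≤ lengthVariation cv p r v → v = 0 := fun v =>
    eq_zero_of_lengthVariation_nonneg hside hpack hjam
  have hlt := two_mul_lt_card_tricuspContact hn hrigid
  have hker := card_le_finrank_ker_of_algebraicIndependent hside p r _ _ hgen
  have hrank := LinearMap.finrank_range_add_finrank_ker
    ((lengthVariation cv p r).coprod (-radiusVariation cv p r))
  rw [LinearMap.range_eq_top.2 (surjective_lengthVariation_coprod hside hpack), finrank_top,
    Module.finrank_fintype_fun_eq_card, Module.finrank_prod, Module.finrank_pi_fintype,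
    Module.finrank_fintype_fun_eq_card] at hrank
  simp only [finrank_euclideanSpace, Fintype.card_fin, Finset.sum_const, Finset.card_univ,
    smul_eq_mul] at hrank hker
  have hstress := finrank_tricuspStressSpace (injective_lengthVariation hrigid)
  rw [ncard_diskContact_add]
  omega

end IsostaticPaper
end
end

section
/- A packing P of n disks in a flat torus 𝕋² = ℝ²/Λ is collectively jammed if and only if it is infinitesimally rigid. -/
noncomputable section

open scoped RealInnerProductSpace

namespace IsostaticPaper

open Filter Topology

/-- A lattice in the plane meets every closed ball in a finite set. -/
lemma finite_lat_inter_closedBall {v₁ v₂ : Pt} (hli : LinearIndependent ℝ ![v₁, v₂]) (R : ℝ) :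
    (lat v₁ v₂ ∩ Metric.closedBall 0 R).Finite := by
  have hcard : Fintype.card (Fin 2) = Module.finrank ℝ Pt := by simp
  set b := basisOfLinearIndependentOfCardEqFinrank hli hcard with hb
  have hfin := ZSpan.setFinite_inter b (Metric.isBounded_closedBall (x := (0 : Pt)) (r := R))
  refine hfin.subset ?_
  rintro l ⟨⟨z₁, z₂, rfl⟩, hl⟩
  refine ⟨hl, ?_⟩
  have h (i : Fin 2) : b i ∈ Submodule.span ℤ (Set.range b) :=
    Submodule.subset_span ⟨i, rfl⟩
  have := add_mem (zsmul_mem (h 0) z₁) (zsmul_mem (h 1) z₂)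
  simpa [hb, Int.cast_smul_eq_zsmul] using this

/-- A vector moved in a direction in which it does not shorten to first order,
does not shorten at all. -/
lemma norm_le_norm_add_smul {e d : Pt} (h : 0 ≤ ⟪e, d⟫) {t : ℝ} (ht : 0 ≤ t) :
    ‖e‖ ≤ ‖e + t • d‖ := by
  refine le_of_sq_le_sq ?_ (norm_nonneg _)
  rw [norm_add_sq_real, real_inner_smul_right]
  nlinarith [mul_nonneg ht h, sq_nonneg ‖t • d‖]

/-- Moving a packing along an infinitesimal flex keeps it a packing for a short time. -/
lemma IsInfFlex.eventually_isPacking {v₁ v₂ : Pt} (hli : LinearIndependent ℝ ![v₁, v₂])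
    {ι : Type} [Finite ι] {p : ι → Pt} {r : ι → ℝ} (hpack : IsPacking (lat v₁ v₂) p r)
    {p' : ι → Pt} (hflex : IsInfFlex (lat v₁ v₂) p r p') :
    ∀ᶠ t in 𝓝[≥] (0 : ℝ), IsPacking (lat v₁ v₂) (fun i => p i + t • p' i) r := by
  have key (i j : ι) : ∀ᶠ t in 𝓝[≥] (0 : ℝ), ∀ l ∈ lat v₁ v₂, ¬(j = i ∧ l = 0) →
      r i + r j ≤ ‖p i - p j + l + t • (p' i - p' j)‖ := by
    set R := r i + r j + ‖p i - p j‖ + ‖p' i - p' j‖ with hR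
    have near : ∀ᶠ t in 𝓝[≥] (0 : ℝ), ∀ l ∈ lat v₁ v₂ ∩ Metric.closedBall 0 R,
        ¬(j = i ∧ l = 0) → r i + r j ≤ ‖p i - p j + l + t • (p' i - p' j)‖ := by
      rw [eventually_all_finite (finite_lat_inter_closedBall hli R)]
      rintro l ⟨hl, -⟩
      by_cases hne : j = i ∧ l = 0
      · simp [hne]
      rcases (hpack.2 i j l hl hne).eq_or_lt with heq | hlt
      · filter_upwards [self_mem_nhdsWithin] with t ht _
        rw [heq]
        exact norm_le_norm_add_smul (hflex (i, j, l) ⟨hl, hne, heq.symm⟩) ht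
      · have hc : Continuous fun t : ℝ => ‖p i - p j + l + t • (p' i - p' j)‖ := by fun_prop
        have hev : ∀ᶠ t in 𝓝 (0 : ℝ), r i + r j < ‖p i - p j + l + t • (p' i - p' j)‖ :=
          hc.continuousAt.eventually_const_lt (by simpa using hlt)
        filter_upwards [hev.filter_mono nhdsWithin_le_nhds] with t ht _ using ht.le
    have hle : ∀ᶠ t in 𝓝[≥] (0 : ℝ), t ≤ 1 :=
      (eventually_le_nhds zero_lt_one).filter_mono nhdsWithin_le_nhds
    filter_upwards [near, hle, self_mem_nhdsWithin] with t hnear ht ht0 l hl hne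
    by_cases hlR : ‖l‖ ≤ R
    · exact hnear l ⟨hl, by simpa using hlR⟩ hne
    · have hsmul : ‖t • (p' i - p' j)‖ ≤ ‖p' i - p' j‖ := by
        rw [norm_smul, Real.norm_of_nonneg ht0]
        exact mul_le_of_le_one_left (norm_nonneg _) ht
      have htri : ‖l‖ ≤ ‖p i - p j + l + t • (p' i - p' j)‖ + ‖p i - p j‖
          + ‖t • (p' i - p' j)‖ := by
        calc ‖l‖ = ‖(p i - p j + l + t • (p' i - p' j)) - (p i - p j) - t • (p' i - p' j)‖ := by
              congr 1; abel
          _ ≤ _ := (norm_sub_le _ _).trans (by gcongr; exact norm_sub_le _ _)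
      linarith
  filter_upwards [eventually_all.2 fun i => eventually_all.2 (key i)] with t ht
  refine ⟨hpack.1, fun i j l hl hne => (ht i j l hl hne).trans_eq ?_⟩
  congr 1
  module

/-- A collectively jammed packing in a flat torus is infinitesimally rigid. -/
lemma CollectivelyJammed.infinitesimallyRigid {v₁ v₂ : Pt}
    (hli : LinearIndependent ℝ ![v₁, v₂]) {ι : Type} [Finite ι] {p : ι → Pt} {r : ι → ℝ}
    (hpack : IsPacking (lat v₁ v₂) p r) (hjam : CollectivelyJammed (lat v₁ v₂) p r) :
    InfinitesimallyRigid (lat v₁ v₂) p r := by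
  intro p' hflex i j
  obtain ⟨ε, hε, hsub⟩ := mem_nhdsGE_iff_exists_Icc_subset.1 (hflex.eventually_isPacking hli hpack)
  have hε : 0 < ε := hε
  have hmove := hjam (fun t i => p i + (ε * t) • p' i) (fun i => by fun_prop) (by simp)
    (fun t ht => hsub ⟨mul_nonneg hε.le ht.1, mul_le_of_le_one_right hε.le ht.2⟩) 1
    (by simp) i j
  simpa [hε.ne'] using hmove

/-- An infinitesimally rigid packing is isolated up to translation: every packing that is close
to a translate of it is a translate of it. -/
lemma InfinitesimallyRigid.exists_isolating {Λ : Set Pt} {ι : Type} [Finite ι] {p : ι → Pt}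
    {r : ι → ℝ} (hrig : InfinitesimallyRigid Λ p r) :
    ∃ δ > 0, ∀ q : ι → Pt, IsPacking Λ q r →
      (∀ i j, ‖(q i - p i) - (q j - p j)‖ < δ) → ∀ i j, q i - p i = q j - p j := by
  have := Fintype.ofFinite ι
  by_contra! hcon
  rcases isEmpty_or_nonempty ι with hι | ⟨⟨o⟩⟩
  · obtain ⟨q, -, -, i, -⟩ := hcon 1 one_pos
    exact hι.elim i
  choose q hq hclose a b hab using fun k : ℕ => hcon (1 / ((k : ℝ) + 1)) Nat.one_div_pos_of_nat
  set w : ℕ → ι → Pt := fun k i => (q k i - p i) - (q k o - p o) with hw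
  have hw_ne (k : ℕ) : w k ≠ 0 := fun h0 => hab k <| by
    have ha := congrFun h0 (a k)
    have hb := congrFun h0 (b k)
    simp only [hw, Pi.zero_apply] at ha hb
    rw [sub_eq_zero.1 ha, sub_eq_zero.1 hb]
  have hw_pos (k : ℕ) : 0 < ‖w k‖ := norm_pos_iff.2 (hw_ne k)
  have hw_lim : Tendsto (fun k => ‖w k‖) atTop (𝓝 0) :=
    squeeze_zero (fun _ => norm_nonneg _)
      (fun k => (pi_norm_le_iff_of_nonneg Nat.one_div_pos_of_nat.le).2 fun i =>
        (hclose k i o).le) tendsto_one_div_add_atTop_nhds_zero_nat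
  obtain ⟨u, hu, φ, hφ, hlim⟩ := (isCompact_sphere (0 : ι → Pt) 1).tendsto_subseq
    (x := fun k => ‖w k‖⁻¹ • w k) (fun k => by simp [norm_smul, hw_ne k])
  have hlim_apply (i : ι) : Tendsto (fun k => ‖w (φ k)‖⁻¹ • w (φ k) i) atTop (𝓝 (u i)) :=
    tendsto_pi_nhds.1 hlim i
  have hflex : IsInfFlex Λ p r u := by
    rintro ⟨i, j, l⟩ ⟨hl, hne, hnorm⟩
    dsimp only at hl hne hnorm ⊢
    set e := p i - p j + l with he
    set d : ℕ → Pt := fun k => ‖w (φ k)‖⁻¹ • w (φ k) i - ‖w (φ k)‖⁻¹ • w (φ k) j with hd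
    have hd_lim : Tendsto d atTop (𝓝 (u i - u j)) := (hlim_apply i).sub (hlim_apply j)
    have hexp (k : ℕ) : 0 ≤ 2 * ⟪e, d k⟫ + ‖w (φ k)‖ * ‖d k‖ ^ 2 := by
      have hwk := hw_pos (φ k)
      have hmove : q (φ k) i - q (φ k) j + l = e + ‖w (φ k)‖ • d k := by
        simp only [hd, ← smul_sub]
        rw [smul_inv_smul₀ hwk.ne']
        simp only [hw, he]
        abel
      have hpk := (hq (φ k)).2 i j l hl hne
      rw [hmove, ← hnorm] at hpk
      have hsq := pow_le_pow_left₀ (norm_nonneg _) hpk 2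
      rw [norm_add_sq_real e, real_inner_smul_right, norm_smul, norm_norm] at hsq
      refine nonneg_of_mul_nonneg_right ?_ hwk
      linarith
    have hlim' : Tendsto (fun k => 2 * ⟪e, d k⟫ + ‖w (φ k)‖ * ‖d k‖ ^ 2) atTop
        (𝓝 (2 * ⟪e, u i - u j⟫ + 0 * ‖u i - u j‖ ^ 2)) :=
      ((tendsto_const_nhds.inner hd_lim).const_mul 2).add
        ((hw_lim.comp hφ.tendsto_atTop).mul (hd_lim.norm.pow 2))
    have := ge_of_tendsto' hlim' hexp
    linarith
  have hu_o : u o = 0 := tendsto_nhds_unique (hlim_apply o) (by simp [hw])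
  have hu_zero : u = 0 := funext fun i => (hrig u hflex i o).trans hu_o
  simp [hu_zero] at hu

/-- An infinitesimally rigid packing is collectively jammed. -/
lemma InfinitesimallyRigid.collectivelyJammed {Λ : Set Pt} {ι : Type} [Finite ι] {p : ι → Pt}
    {r : ι → ℝ} (hrig : InfinitesimallyRigid Λ p r) : CollectivelyJammed Λ p r := by
  intro q hcont h0 hq
  obtain ⟨δ, hδ, hiso⟩ := hrig.exists_isolating
  have hdiff (i j : ι) : ContinuousOn (fun t => (q t i - p i) - (q t j - p j)) (Set.Icc 0 1) :=
    ((hcont i).sub continuousOn_const).sub ((hcont j).sub continuousOn_const)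
  set S : Set ℝ := {t | ∀ i j, q t i - p i = q t j - p j} with hS
  have hclosed : IsClosed (S ∩ Set.Icc 0 1) := by
    have : S ∩ Set.Icc 0 1 = Set.Icc 0 1 ∩ ⋂ (i) (j),
        Set.Icc 0 1 ∩ (fun t => (q t i - p i) - (q t j - p j)) ⁻¹' {0} := by
      ext t
      simp only [hS, Set.mem_inter_iff, Set.mem_ofPred_eq, Set.mem_iInter, Set.mem_preimage,
        Set.mem_singleton_iff, sub_eq_zero]
      exact ⟨fun h => ⟨h.2, fun i j => ⟨h.2, h.1 i j⟩⟩, fun h => ⟨fun i j => (h.2 i j).2, h.1⟩⟩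
    rw [this]
    exact isClosed_Icc.inter <| isClosed_iInter fun i => isClosed_iInter fun j =>
      (hdiff i j).preimage_isClosed_of_isClosed isClosed_Icc isClosed_singleton
  refine hclosed.Icc_subset_of_forall_mem_nhdsWithin (by simp [hS, h0]) ?_
  rintro x ⟨hxS, hx⟩
  have hIcc : Set.Icc (0 : ℝ) 1 ∈ 𝓝[>] x :=
    mem_of_superset (Ioc_mem_nhdsGT hx.2) fun t ht => ⟨hx.1.trans ht.1.le, ht.2⟩
  have hsmall (i j : ι) : ∀ᶠ t in 𝓝[>] x, ‖(q t i - p i) - (q t j - p j)‖ < δ := by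
    have hlim := ((hdiff i j).norm x (Set.Ico_subset_Icc_self hx)).eventually_lt_const
      (by simpa [hxS i j] using hδ)
    exact hlim.filter_mono (nhdsWithin_le_of_mem hIcc)
  filter_upwards [hIcc, eventually_all.2 fun i => eventually_all.2 (hsmall i)] with t ht hlt
  exact hiso (q t) (hq t ht) hlt

/-- **Theorem 2.1 (Danzer).**  A packing `(p, r)` in the flat torus `ℝ²/Λ`, `Λ`
spanned by the linearly independent vectors `v₁, v₂`, is collectively jammed if and
only if it is infinitesimally rigid. -/
theorem collectivelyJammed_iff_infinitesimallyRigid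
    (v₁ v₂ : Pt) (hli : LinearIndependent ℝ ![v₁, v₂])
    (n : ℕ) (p : Fin n → Pt) (r : Fin n → ℝ)
    (hpack : IsPacking (lat v₁ v₂) p r) :
    CollectivelyJammed (lat v₁ v₂) p r ↔ InfinitesimallyRigid (lat v₁ v₂) p r := by
  exact ⟨CollectivelyJammed.infinitesimallyRigid hli hpack,
    InfinitesimallyRigid.collectivelyJammed⟩

end IsostaticPaper
end
end

section
/- Let P = (p, r) be a locally maximally dense packing of n disks in a flat torus 𝕋² = ℝ²/Λ. For every ε > 0 there exists δ > 0 such that for every packing (q, s) in 𝕋² with |q − p| < δ and |s − r| < δ, there exists a locally maximally dense packing (q(1), s(1)) in 𝕋² with |q(1) − p| < ε and with s(1) a positive scalar multiple of s (the same radius ratios as s). -/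
noncomputable section

open scoped RealInnerProductSpace

namespace IsostaticPaper

section LocalMaxima

open Filter Topology

variable {n : ℕ} {v₁ v₂ : Pt}

theorem finite_lat_norm_le (hli : LinearIndependent ℝ ![v₁, v₂]) (R : ℝ) :
    {l ∈ lat v₁ v₂ | ‖l‖ ≤ R}.Finite := by
  let b := basisOfLinearIndependentOfCardEqFinrank hli (by simp)
  refine (ZSpan.setFinite_inter b (Metric.isBounded_closedBall (x := (0 : Pt)) (r := R))).subset ?_
  rintro l ⟨⟨z₁, z₂, rfl⟩, hR⟩
  refine ⟨by simpa using hR, ?_⟩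
  have hb : Set.range b = Set.range ![v₁, v₂] := by simp [b]
  rw [hb, SetLike.mem_coe]
  have h (i : Fin 2) : ![v₁, v₂] i ∈ Submodule.span ℤ (Set.range ![v₁, v₂]) :=
    Submodule.subset_span ⟨i, rfl⟩
  rw [Int.cast_smul_eq_zsmul, Int.cast_smul_eq_zsmul]
  exact add_mem (Submodule.smul_mem _ _ (h 0)) (Submodule.smul_mem _ _ (h 1))

theorem det2_ne_zero (hli : LinearIndependent ℝ ![v₁, v₂]) : det2 v₁ v₂ ≠ 0 := by
  intro h
  rw [det2] at h
  rw [LinearIndependent.pair_iff] at hli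
  have h₁ := hli (v₂ 1) (-v₁ 1) (by ext i; fin_cases i <;> simp <;> linarith)
  have h₀ := hli (v₂ 0) (-v₁ 0) (by ext i; fin_cases i <;> simp <;> linarith)
  have hz : v₁ = 0 := by
    ext i
    fin_cases i
    · simpa using h₀.2
    · simpa using h₁.2
  simpa using (hli 1 0 (by simp [hz])).1

theorem norm_sub_add_le {p q : Fin n → Pt} (i j : Fin n) (l : Pt) :
    ‖p i - p j + l‖ ≤ ‖q i - q j + l‖ + 2 * dist q p := by
  have hi := dist_le_pi_dist q p i
  have hj := dist_le_pi_dist q p j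
  rw [dist_eq_norm] at hi hj
  have h : p i - p j + l = q i - q j + l + ((q j - p j) - (q i - p i)) := by abel
  rw [h]
  have := norm_add_le (q i - q j + l) ((q j - p j) - (q i - p i))
  have := norm_sub_le (q j - p j) (q i - p i)
  linarith

theorem finite_norm_le (hli : LinearIndependent ℝ ![v₁, v₂]) (p : Fin n → Pt) (r : Fin n → ℝ) :
    {c : Fin n × Fin n × Pt | c.2.2 ∈ lat v₁ v₂ ∧
      ‖p c.1 - p c.2.1 + c.2.2‖ ≤ r c.1 + r c.2.1 + 1}.Finite := by
  refine (Set.finite_iUnion fun i : Fin n => Set.finite_iUnion fun j : Fin n =>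
    (finite_lat_norm_le hli (r i + r j + 1 + ‖p i - p j‖)).image (fun l => (i, j, l))).subset ?_
  rintro ⟨i, j, l⟩ ⟨hl, h⟩
  simp only [Set.mem_iUnion]
  refine ⟨i, j, l, ⟨hl, ?_⟩, rfl⟩
  have := norm_sub_le (p i - p j + l) (p i - p j)
  simp only [add_sub_cancel_left] at this h
  linarith

theorem finite_contacts (hli : LinearIndependent ℝ ![v₁, v₂]) (p : Fin n → Pt) (r : Fin n → ℝ) :
    {c | IsContact (lat v₁ v₂) p r c}.Finite :=
  (finite_norm_le hli p r).subset fun _ hc => ⟨hc.1, by rw [hc.2.2]; linarith⟩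

/-- Pairs of disks not in contact stay uniformly separated under small motions. -/
theorem exists_gap (hli : LinearIndependent ℝ ![v₁, v₂]) {p : Fin n → Pt} {r : Fin n → ℝ}
    (hp : IsPacking (lat v₁ v₂) p r) :
    ∃ γ > 0, ∀ᶠ q in 𝓝 p, ∀ i j, ∀ l ∈ lat v₁ v₂, ¬(j = i ∧ l = 0) →
      ¬IsContact (lat v₁ v₂) p r (i, j, l) → r i + r j + γ < ‖q i - q j + l‖ := by
  have hγ : ∀ᶠ γ : ℝ in 𝓝 0, ∀ c ∈ {c : Fin n × Fin n × Pt | c.2.2 ∈ lat v₁ v₂ ∧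
      ‖p c.1 - p c.2.1 + c.2.2‖ ≤ r c.1 + r c.2.1 + 1}, ¬(c.2.1 = c.1 ∧ c.2.2 = 0) →
      ¬IsContact (lat v₁ v₂) p r c →
      r c.1 + r c.2.1 + 2 * γ < ‖p c.1 - p c.2.1 + c.2.2‖ := by
    rw [eventually_all_finite (finite_norm_le hli p r)]
    rintro ⟨i, j, l⟩ ⟨hl, -⟩
    by_cases hc : r i + r j < ‖p i - p j + l‖
    · have : ContinuousAt (fun γ : ℝ => r i + r j + 2 * γ) 0 := by fun_prop
      filter_upwards [this.eventually_lt continuousAt_const (by simpa using hc)] with γ h _ _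
      exact h
    · refine .of_forall fun γ ht hn => absurd ⟨hl, ht, ?_⟩ hn
      exact le_antisymm (not_lt.1 hc) (hp.2 i j l hl ht)
  obtain ⟨γ, ⟨hγ, hγ'⟩, hpos⟩ := ((hγ.and (gt_mem_nhds (one_half_pos (α := ℝ)))).filter_mono
    nhdsWithin_le_nhds |>.and (self_mem_nhdsWithin (s := Set.Ioi (0 : ℝ)))).exists
  have hpos : 0 < γ := hpos
  refine ⟨γ, hpos, ?_⟩
  filter_upwards [Metric.ball_mem_nhds p (half_pos hpos)] with q hq i j l hl ht hn
  have hd := norm_sub_add_le (p := p) (q := q) i j l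
  have hq : dist q p < γ / 2 := hq
  suffices r i + r j + 2 * γ < ‖p i - p j + l‖ by linarith
  by_cases hc : ‖p i - p j + l‖ ≤ r i + r j + 1
  · exact hγ (i, j, l) ⟨hl, hc⟩ ht hn
  · linarith

theorem continuous_pdist (p : Fin n → Pt) : Continuous fun q => pdist q p := by
  unfold pdist
  fun_prop

theorem continuous_rdist (r : Fin n → ℝ) : Continuous fun s => rdist s r := by
  unfold rdist
  fun_prop

theorem dist_le_pdist (p q : Fin n → Pt) : dist q p ≤ pdist q p := by
  refine (dist_pi_le_iff (Real.sqrt_nonneg _)).2 fun i => Real.le_sqrt_of_sq_le ?_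
  rw [dist_eq_norm]
  exact Finset.single_le_sum (f := fun i => ‖q i - p i‖ ^ 2) (fun _ _ => sq_nonneg _)
    (Finset.mem_univ i)

theorem dist_le_rdist (r s : Fin n → ℝ) : dist s r ≤ rdist s r := by
  refine (dist_pi_le_iff (Real.sqrt_nonneg _)).2 fun i => Real.le_sqrt_of_sq_le ?_
  rw [Real.dist_eq, sq_abs]
  exact Finset.single_le_sum (f := fun i => (s i - r i) ^ 2) (fun _ _ => sq_nonneg _)
    (Finset.mem_univ i)

theorem density_smul (r : Fin n → ℝ) (t : ℝ) :
    density v₁ v₂ (fun i => t * r i) = t ^ 2 * density v₁ v₂ r := by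
  simp only [density, mul_pow, ← Finset.mul_sum]
  ring

theorem density_nonneg (r : Fin n → ℝ) : 0 ≤ density v₁ v₂ r := by
  unfold density
  positivity

theorem density_pos [NeZero n] (hli : LinearIndependent ℝ ![v₁, v₂]) {r : Fin n → ℝ}
    (hr : ∀ i, 0 < r i) : 0 < density v₁ v₂ r := by
  have := det2_ne_zero hli
  have : 0 < ∑ i, r i ^ 2 :=
    Finset.sum_pos (fun i _ => pow_pos (hr i) 2) Finset.univ_nonempty
  unfold density
  positivity

/-- A packing close to a locally maximally dense one with the same radii has a contact. -/
theorem eventually_exists_contact [NeZero n] (hli : LinearIndependent ℝ ![v₁, v₂])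
    {p : Fin n → Pt} {r : Fin n → ℝ} (hmax : LocallyMaxDense v₁ v₂ p r) :
    ∀ᶠ q in 𝓝 p, IsPacking (lat v₁ v₂) q r → ∃ c, IsContact (lat v₁ v₂) q r c := by
  obtain ⟨hp, ε, hε, hmax⟩ := hmax
  have hq := (continuous_pdist p).continuousAt.eventually_lt (x₀ := p) continuousAt_const
    (by simpa [pdist] using hε)
  filter_upwards [hq] with q hq hpack
  by_contra! hno
  obtain ⟨γ, hγ, hgap⟩ := exists_gap hli hpack
  have hgap := hgap.self_of_nhds
  have h₁ : ∀ᶠ t : ℝ in 𝓝 1, rdist (fun i => t * r i) r < ε := by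
    have hc : Continuous fun t : ℝ => rdist (fun i => t * r i) r :=
      (continuous_rdist r).comp (by fun_prop)
    exact hc.continuousAt.eventually_lt continuousAt_const (by simpa [rdist] using hε)
  have h₂ : ∀ᶠ t : ℝ in 𝓝 1, ∀ i j, t * r i + t * r j < r i + r j + γ := by
    rw [eventually_all]; intro i
    rw [eventually_all]; intro j
    have hc : Continuous fun t : ℝ => t * r i + t * r j := by fun_prop
    exact hc.continuousAt.eventually_lt continuousAt_const (by simpa using hγ)
  obtain ⟨t, ⟨h₁, h₂⟩, ht⟩ := ((h₁.and h₂).filter_mono nhdsWithin_le_nhds |>.and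
    (self_mem_nhdsWithin (s := Set.Ioi (1 : ℝ)))).exists
  have ht : 1 < t := ht
  have ht₀ : 0 < t := by linarith
  have := hmax q t ht₀ ⟨fun i => mul_pos ht₀ (hp.1 i), fun i j l hl hne =>
    (h₂ i j).le.trans (hgap i j l hl hne (hno _)).le⟩ hq h₁
  rw [density_smul] at this
  have hd := density_pos hli hp.1
  have := one_lt_pow₀ ht two_ne_zero
  nlinarith

/-- Moving along an infinitesimal flex keeps the packing and breaks every contact that the flex
moves, so a packing with fewest contacts has only flexes that are constant along contacts. -/
theorem exists_packing_flex_eq (hli : LinearIndependent ℝ ![v₁, v₂])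
    {p : Fin n → Pt} {r : Fin n → ℝ} (hp : IsPacking (lat v₁ v₂) p r)
    {U : Set (Fin n → Pt)} (hU : IsOpen U) (hpU : p ∈ U) :
    ∃ q ∈ U, IsPacking (lat v₁ v₂) q r ∧ ∀ h, IsInfFlex (lat v₁ v₂) q r h →
      ∀ c, IsContact (lat v₁ v₂) q r c → h c.1 = h c.2.1 := by
  let N (q : Fin n → Pt) : ℕ := {c | IsContact (lat v₁ v₂) q r c}.ncard
  obtain ⟨q, ⟨hqU, hq⟩, hmin⟩ := WellFounded.has_min (measure N).wf
    {q | q ∈ U ∧ IsPacking (lat v₁ v₂) q r} ⟨p, hpU, hp⟩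
  refine ⟨q, hqU, hq, fun h hflex c hc => ?_⟩
  by_contra hne
  obtain ⟨γ, hγ, hgap⟩ := exists_gap hli hq
  have hlim : Tendsto (fun t : ℝ => q + t • h) (𝓝 0) (𝓝 q) := by
    have : Continuous fun t : ℝ => q + t • h := by fun_prop
    simpa using this.tendsto 0
  obtain ⟨t, ⟨hgap, htU⟩, ht⟩ := (((hlim.eventually hgap).and
    (hlim.eventually (hU.mem_nhds hqU))).filter_mono nhdsWithin_le_nhds |>.and
    (self_mem_nhdsWithin (s := Set.Ioi (0 : ℝ)))).exists
  have ht : 0 < t := ht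
  have hsq (c : Fin n × Fin n × Pt) (hc : IsContact (lat v₁ v₂) q r c) :
      (r c.1 + r c.2.1) ^ 2 + t ^ 2 * ‖h c.1 - h c.2.1‖ ^ 2 ≤
        ‖(q + t • h) c.1 - (q + t • h) c.2.1 + c.2.2‖ ^ 2 := by
    have he : (q + t • h) c.1 - (q + t • h) c.2.1 + c.2.2 =
        (q c.1 - q c.2.1 + c.2.2) + t • (h c.1 - h c.2.1) := by
      simp only [Pi.add_apply, Pi.smul_apply, smul_sub]; abel
    rw [he, norm_add_sq_real, hc.2.2, inner_smul_right, norm_smul, mul_pow, Real.norm_eq_abs,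
      sq_abs]
    have := mul_nonneg ht.le (hflex c hc)
    linarith
  have hpack : IsPacking (lat v₁ v₂) (q + t • h) r := by
    refine ⟨hq.1, fun i j l hl hne => ?_⟩
    by_cases hc : IsContact (lat v₁ v₂) q r (i, j, l)
    · refine le_of_sq_le_sq ?_ (norm_nonneg _)
      have := hsq _ hc
      simp only at this
      nlinarith [sq_nonneg (t * ‖h i - h j‖)]
    · linarith [hgap i j l hl hne hc]
  refine hmin (q + t • h) ⟨htU, hpack⟩
    (Set.ncard_lt_ncard ⟨?_, fun hsub => ?_⟩ (finite_contacts hli q r))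
  · rintro ⟨i, j, l⟩ hc
    by_contra hn
    have := hgap i j l hc.1 hc.2.1 hn
    have := hc.2.2
    simp only at this
    linarith
  · have h₁ := (hsub hc).2.2
    have h₂ := hsq c hc
    rw [h₁] at h₂
    have : 0 < ‖h c.1 - h c.2.1‖ := norm_pos_iff.2 (sub_ne_zero.2 hne)
    have : 0 < t ^ 2 * ‖h c.1 - h c.2.1‖ ^ 2 := by positivity
    linarith

/-- The largest factor by which the radii `s` may be scaled so that the disks with centers `q`
do not overlap along the pairs in `D`. -/
def scale (D : Finset (Fin n × Fin n × Pt)) (hD : D.Nonempty) (s : Fin n → ℝ)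
    (q : Fin n → Pt) : ℝ :=
  D.inf' hD fun c => ‖q c.1 - q c.2.1 + c.2.2‖ / (s c.1 + s c.2.1)

theorem le_scale_iff {D : Finset (Fin n × Fin n × Pt)} (hD : D.Nonempty) {s : Fin n → ℝ}
    (hs : ∀ i, 0 < s i) {q : Fin n → Pt} {t : ℝ} :
    t ≤ scale D hD s q ↔
      ∀ c ∈ D, t * (s c.1 + s c.2.1) ≤ ‖q c.1 - q c.2.1 + c.2.2‖ := by
  simp only [scale, Finset.le_inf'_iff]
  exact forall₂_congr fun c _ => le_div_iff₀ (add_pos (hs _) (hs _))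

theorem continuousAt_scale {X : Type*} [TopologicalSpace X] {D : Finset (Fin n × Fin n × Pt)}
    (hD : D.Nonempty) {f : X → Fin n → ℝ} {g : X → Fin n → Pt} {x : X} (hf : ContinuousAt f x)
    (hg : ContinuousAt g x) (hs : ∀ i, 0 < f x i) :
    ContinuousAt (fun y => scale D hD (f y) (g y)) x := by
  refine ContinuousAt.finset_inf'_apply hD fun c _ => ?_
  have hf (i : Fin n) : ContinuousAt (fun y => f y i) x := continuousAt_pi.1 hf i
  have hg (i : Fin n) : ContinuousAt (fun y => g y i) x := continuousAt_pi.1 hg i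
  exact ContinuousAt.div (by fun_prop) (by fun_prop) (add_pos (hs _) (hs _)).ne'

/-- If no flex in the subspace `V` other than `0` preserves the contacts to first order, then
every small nonzero displacement in `V` strictly shortens some contact. -/
theorem exists_radius_contact_lt {D : Finset (Fin n × Fin n × Pt)} {q : Fin n → Pt}
    {V : Submodule ℝ (Fin n → Pt)}
    (hV : ∀ h ∈ V, (∀ c ∈ D, 0 ≤ ⟪q c.1 - q c.2.1 + c.2.2, h c.1 - h c.2.1⟫) → h = 0) :
    ∃ ρ > 0, ∀ h ∈ V, h ≠ 0 → ‖h‖ ≤ ρ →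
      ∃ c ∈ D, ‖(q + h) c.1 - (q + h) c.2.1 + c.2.2‖ < ‖q c.1 - q c.2.1 + c.2.2‖ := by
  have hK : IsCompact (Metric.sphere (0 : Fin n → Pt) 1 ∩ V) :=
    (isCompact_sphere _ _).inter_right V.closed_of_finiteDimensional
  have hev : ∀ᶠ t : ℝ in 𝓝 0, ∀ u ∈ Metric.sphere (0 : Fin n → Pt) 1 ∩ V, ∃ c ∈ D,
      2 * ⟪q c.1 - q c.2.1 + c.2.2, u c.1 - u c.2.1⟫ + t * ‖u c.1 - u c.2.1‖ ^ 2 < 0 := by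
    refine hK.eventually_forall_of_forall_eventually fun u hu => ?_
    have hu₀ : u ≠ 0 := by
      rintro rfl
      simpa using hu.1
    have := mt (hV u hu.2) hu₀
    push Not at this
    obtain ⟨c, hc, hneg⟩ := this
    have hcont : Continuous fun z : ℝ × (Fin n → Pt) =>
        2 * ⟪q c.1 - q c.2.1 + c.2.2, z.2 c.1 - z.2 c.2.1⟫ + z.1 * ‖z.2 c.1 - z.2 c.2.1‖ ^ 2 := by
      fun_prop
    filter_upwards [(hcont.tendsto ((0 : ℝ), u)).eventually_lt_const (u := 0)
      (by simp only [zero_mul]; linarith)] with z hz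
    exact ⟨c, hc, hz⟩
  obtain ⟨ρ, hρ, hball⟩ := Metric.eventually_nhds_iff.1 hev
  refine ⟨ρ / 2, half_pos hρ, fun h hh hne hle => ?_⟩
  have hpos : 0 < ‖h‖ := norm_pos_iff.2 hne
  obtain ⟨c, hc, hlt⟩ := hball (y := ‖h‖) (by simp; linarith) (‖h‖⁻¹ • h)
    ⟨by simp [norm_smul, hpos.ne'], V.smul_mem _ hh⟩
  refine ⟨c, hc, lt_of_pow_lt_pow_left₀ 2 (norm_nonneg _) ?_⟩
  have he : (q + h) c.1 - (q + h) c.2.1 + c.2.2 =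
      (q c.1 - q c.2.1 + c.2.2) + (h c.1 - h c.2.1) := by
    simp only [Pi.add_apply]; abel
  rw [he, norm_add_sq_real]
  have hinner : ⟪q c.1 - q c.2.1 + c.2.2, (‖h‖⁻¹ • h) c.1 - (‖h‖⁻¹ • h) c.2.1⟫ =
      ‖h‖⁻¹ * ⟪q c.1 - q c.2.1 + c.2.2, h c.1 - h c.2.1⟫ := by
    simp only [Pi.smul_apply, ← smul_sub, inner_smul_right]
  have hnorm : ‖h‖ * ‖(‖h‖⁻¹ • h) c.1 - (‖h‖⁻¹ • h) c.2.1‖ ^ 2 =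
      ‖h‖⁻¹ * ‖h c.1 - h c.2.1‖ ^ 2 := by
    simp only [Pi.smul_apply, ← smul_sub, norm_smul, norm_inv, norm_norm]
    field_simp
  rw [hinner, hnorm] at hlt
  have hlt : ‖h‖⁻¹ * (2 * ⟪q c.1 - q c.2.1 + c.2.2, h c.1 - h c.2.1⟫ +
      ‖h c.1 - h c.2.1‖ ^ 2) < 0 := by linarith
  have := neg_of_mul_neg_right hlt (inv_nonneg.2 hpos.le)
  linarith

/-- Near a packing with a contact all of whose infinitesimal flexes are constant along contacts,
there are locally maximally dense packings for all nearby radius ratios. -/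
theorem eventually_exists_locallyMaxDense (hli : LinearIndependent ℝ ![v₁, v₂])
    {p : Fin n → Pt} {r : Fin n → ℝ} (hp : IsPacking (lat v₁ v₂) p r)
    (hcontact : ∃ c, IsContact (lat v₁ v₂) p r c)
    (hflex : ∀ h, IsInfFlex (lat v₁ v₂) p r h →
      ∀ c, IsContact (lat v₁ v₂) p r c → h c.1 = h c.2.1)
    {U : Set (Fin n → Pt)} (hU : U ∈ 𝓝 p) :
    ∀ᶠ s in 𝓝 r, ∃ q ∈ U, ∃ t : ℝ, 0 < t ∧ LocallyMaxDense v₁ v₂ q fun i => t * s i := by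
  let D := (finite_contacts hli p r).toFinset
  have memD (c) : c ∈ D ↔ IsContact (lat v₁ v₂) p r c := by simp [D]
  have hD : D.Nonempty := hcontact.imp fun c hc => (memD c).2 hc
  let W : Submodule ℝ (Fin n → Pt) :=
    { carrier := {h | ∀ c ∈ D, h c.1 = h c.2.1}
      add_mem' := fun ha hb c hc => by simp [ha c hc, hb c hc]
      zero_mem' := fun c _ => rfl
      smul_mem' := fun t h hh c hc => by simp [hh c hc] }
  obtain ⟨V, hWV⟩ := W.exists_isCompl
  obtain ⟨ρ₀, hρ₀, hshort⟩ := exists_radius_contact_lt (D := D) (q := p) (V := V)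
    fun h hh hnonneg => by
      have hW : h ∈ W := fun c hc =>
        hflex h (fun c hc => hnonneg c ((memD c).2 hc)) c ((memD c).1 hc)
      exact Submodule.disjoint_def.1 hWV.disjoint h hW hh
  obtain ⟨γ, hγ, hgap⟩ := exists_gap hli hp
  obtain ⟨ρ₁, hρ₁, hball⟩ := Metric.eventually_nhds_iff.1 (hgap.and hU)
  obtain ⟨ρ, hρ, hρlt⟩ := exists_between (lt_min hρ₀ hρ₁)
  have hgap (h : Fin n → Pt) (hh : ‖h‖ ≤ ρ) := hball (y := p + h) (by
    simpa using hh.trans_lt (hρlt.trans_le (min_le_right _ _)))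
  have hself : scale D hD r p = 1 := by
    refine le_antisymm ?_ ((le_scale_iff hD hp.1).2 fun c hc => ?_)
    · obtain ⟨c, hc⟩ := id hD
      have := (le_scale_iff hD hp.1 (q := p)).1 le_rfl c hc
      rw [((memD c).1 hc).2.2] at this
      exact le_of_mul_le_mul_right (by simpa using this) (add_pos (hp.1 c.1) (hp.1 c.2.1))
    · rw [((memD c).1 hc).2.2, one_mul]
  have hlt (h : Fin n → Pt) (hh : h ∈ V) (hne : h ≠ 0) (hle : ‖h‖ ≤ ρ) :
      scale D hD r (p + h) < 1 := by
    obtain ⟨c, hc, hcl⟩ := hshort h hh hne (hle.trans (hρlt.le.trans (min_le_left _ _)))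
    by_contra! hge
    have := (le_scale_iff hD hp.1).1 hge c hc
    rw [((memD c).1 hc).2.2] at hcl
    linarith
  have hcont (h : Fin n → Pt) : ContinuousAt
      (fun z : (Fin n → ℝ) × (Fin n → Pt) => scale D hD z.1 (p + z.2)) (r, h) :=
    continuousAt_scale hD (by fun_prop) (by fun_prop) hp.1
  have hcont₀ (h : Fin n → Pt) : ContinuousAt
      (fun z : (Fin n → ℝ) × (Fin n → Pt) => scale D hD z.1 p) (r, h) :=
    continuousAt_scale hD (by fun_prop) (by fun_prop) hp.1
  have hKc : IsCompact (Metric.closedBall (0 : Fin n → Pt) ρ ∩ V) :=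
    (isCompact_closedBall _ _).inter_right V.closed_of_finiteDimensional
  have hSc : IsCompact (Metric.sphere (0 : Fin n → Pt) ρ ∩ V) :=
    (isCompact_sphere _ _).inter_right V.closed_of_finiteDimensional
  have hsphere : ∀ᶠ s in 𝓝 r, ∀ h ∈ Metric.sphere (0 : Fin n → Pt) ρ ∩ V,
      scale D hD s (p + h) < scale D hD s p := by
    refine hSc.eventually_forall_of_forall_eventually fun h hh => ?_
    refine (hcont h).eventually_lt (hcont₀ h) ?_
    have hn : ‖h‖ = ρ := by simpa using hh.1
    rw [hself]
    refine hlt h hh.2 ?_ hn.le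
    rintro rfl
    simp [hρ.ne] at hn
  have hsmall : ∀ᶠ s in 𝓝 r, ∀ h ∈ Metric.closedBall (0 : Fin n → Pt) ρ ∩ V,
      ∀ i j, scale D hD s (p + h) * (s i + s j) < r i + r j + γ := by
    refine hKc.eventually_forall_of_forall_eventually fun h hh => ?_
    rw [eventually_all]; intro i
    rw [eventually_all]; intro j
    refine ((hcont h).mul (by fun_prop)).eventually_lt continuousAt_const ?_
    have hle : scale D hD r (p + h) ≤ 1 := by
      by_cases h₀ : h = 0
      · simp [h₀, hself]
      · exact (hlt h hh.2 h₀ (by simpa using hh.1)).le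
    have := add_pos (hp.1 i) (hp.1 j)
    simp only [Pi.mul_apply]
    nlinarith
  have hspos : ∀ᶠ s in 𝓝 r, ∀ i, 0 < s i := by
    rw [eventually_all]; intro i
    exact continuousAt_const.eventually_lt (continuous_apply i).continuousAt (hp.1 i)
  have hscale : ∀ᶠ s in 𝓝 r, 0 < scale D hD s p := by
    have : ContinuousAt (fun s => scale D hD s p) r :=
      continuousAt_scale hD (by fun_prop) (by fun_prop) hp.1
    exact continuousAt_const.eventually_lt this (by simp [hself])
  filter_upwards [hsphere, hsmall, hspos, hscale] with s hsphere hsmall hs hscale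
  have hscont : Continuous fun h => scale D hD s (p + h) :=
    continuous_iff_continuousAt.2 fun h =>
      continuousAt_scale hD (by fun_prop) (by fun_prop) hs
  have hzero : (0 : Fin n → Pt) ∈ Metric.closedBall (0 : Fin n → Pt) ρ ∩ V :=
    ⟨by simpa using hρ.le, V.zero_mem⟩
  obtain ⟨h, hhK, hhmax⟩ := hKc.exists_isMaxOn ⟨0, hzero⟩ hscont.continuousOn
  have hge : scale D hD s p ≤ scale D hD s (p + h) := by simpa using hhmax hzero
  have hhle : ‖h‖ ≤ ρ := by simpa using hhK.1
  have hhlt : ‖h‖ < ρ := by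
    refine lt_of_le_of_ne hhle fun he => ?_
    exact (hsphere h ⟨by simpa using he, hhK.2⟩).not_ge hge
  have htpos := hscale.trans_le hge
  refine ⟨p + h, (hgap h hhle).2, scale D hD s (p + h), htpos,
    ⟨fun i => mul_pos htpos (hs i), fun i j l hl hne => ?_⟩, ?_⟩
  · rw [← mul_add]
    by_cases hc : IsContact (lat v₁ v₂) p r (i, j, l)
    · exact (le_scale_iff hD hs).1 le_rfl (i, j, l) ((memD _).2 hc)
    · exact (hsmall h hhK i j).le.trans ((hgap h hhle).1 i j l hl hne hc).le
  let P := V.projection W hWV.symm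
  have hP : Continuous P := P.continuous_of_finiteDimensional
  have hPh : P h = h := V.projection_apply_left hWV.symm ⟨h, hhK.2⟩
  have hnear : ∀ᶠ q in 𝓝 (p + h), ‖P (q - p)‖ < ρ := by
    have : Continuous fun q => ‖P (q - p)‖ := by fun_prop
    exact this.continuousAt.eventually_lt continuousAt_const (by simpa [hPh] using hhlt)
  obtain ⟨ε, hε, hnear⟩ := Metric.eventually_nhds_iff.1 hnear
  refine ⟨ε, hε, fun q t ht hq hqd _ => ?_⟩
  rw [density_smul]
  have hPq : P (q - p) ∈ Metric.closedBall (0 : Fin n → Pt) ρ ∩ V :=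
    ⟨by simpa using (hnear ((dist_le_pdist _ _).trans_lt hqd)).le,
      V.projection_apply_mem hWV.symm _⟩
  have hinv : scale D hD s q = scale D hD s (p + P (q - p)) := by
    refine Finset.inf'_congr hD rfl fun c hc => ?_
    have hW : (q - p - P (q - p)) c.1 = (q - p - P (q - p)) c.2.1 :=
      Submodule.sub_projection_mem hWV.symm (q - p) c hc
    have : q c.1 - q c.2.1 = (p + P (q - p)) c.1 - (p + P (q - p)) c.2.1 := by
      simp only [Pi.sub_apply, Pi.add_apply] at hW ⊢
      rw [← sub_eq_zero] at hW ⊢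
      rw [← hW]
      abel
    rw [this]
  have htle : t * scale D hD s (p + h) ≤ scale D hD s q :=
    (le_scale_iff hD hs).2 fun c hc => by
      have := hq.2 c.1 c.2.1 c.2.2 ((memD c).1 hc).1 ((memD c).1 hc).2.1
      linarith
  have ht₁ : t ≤ 1 := by
    have : scale D hD s q ≤ scale D hD s (p + h) := hinv ▸ hhmax hPq
    exact le_of_mul_le_mul_right (by linarith) htpos
  exact mul_le_of_le_one_left (density_nonneg _) (pow_le_one₀ ht.le ht₁)

end LocalMaxima

/-- **Proposition 5.1.**  Let `(p, r)` be a locally maximally dense packing of `n`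
disks in the flat torus `ℝ²/Λ`, `Λ` spanned by the linearly independent vectors
`v₁, v₂`.  For every `ε > 0` there is a `δ > 0` such that every packing `(q, s)`
within `δ` of `(p, r)` admits a locally maximally dense packing `(q₁, s₁)` with
`|q₁ - p| < ε` and `s₁` a positive scalar multiple of `s` (the same radius ratios). -/
theorem nearby_locally_maximally_dense
    (v₁ v₂ : Pt) (hli : LinearIndependent ℝ ![v₁, v₂])
    (n : ℕ) (p : Fin n → Pt) (r : Fin n → ℝ)
    (hmax : LocallyMaxDense v₁ v₂ p r) :
    ∀ ε > 0, ∃ δ > 0, ∀ (q : Fin n → Pt) (s : Fin n → ℝ),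
      IsPacking (lat v₁ v₂) q s → pdist q p < δ → rdist s r < δ →
      ∃ (q₁ : Fin n → Pt) (t : ℝ), 0 < t ∧
        LocallyMaxDense v₁ v₂ q₁ (fun i => t * s i) ∧ pdist q₁ p < ε := by
  intro ε hε
  rcases Nat.eq_zero_or_pos n with rfl | hn
  · refine ⟨1, one_pos, fun q s hs _ _ => ⟨p, 1, one_pos, ?_, by simpa [pdist] using hε⟩⟩
    rwa [Subsingleton.elim (fun i => 1 * s i) r]
  have : NeZero n := ⟨hn.ne'⟩
  have hnear : ∀ᶠ q in nhds p, pdist q p < ε :=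
    (continuous_pdist p).continuousAt.eventually_lt continuousAt_const (by simpa [pdist] using hε)
  obtain ⟨U, hUsub, hU, hpU⟩ := eventually_nhds_iff.1
    (hnear.and (eventually_exists_contact hli hmax))
  obtain ⟨q₀, hq₀U, hq₀, hflex⟩ := exists_packing_flex_eq hli hmax.1 hU hpU
  obtain ⟨δ, hδ, hball⟩ := Metric.eventually_nhds_iff.1
    (eventually_exists_locallyMaxDense hli hq₀ ((hUsub q₀ hq₀U).2 hq₀) hflex (hU.mem_nhds hq₀U))
  refine ⟨δ, hδ, fun q s _ _ hs => ?_⟩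
  obtain ⟨q₁, hq₁, t, ht, hdense⟩ := hball ((dist_le_rdist _ _).trans_lt hs)
  exact ⟨q₁, t, ht, hdense, (hUsub q₁ hq₁).1⟩

end IsostaticPaper
end
end
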